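/- arXiv:1911.10884 — 2 statements merged into one kernel-verified Lean document; each statement's English description precedes it below -/
import Mathlib

section
/- Fix n ∈ ℕ. There exist constants C > 0 and b* ∈ (0,1) such that for every b with 0 < b ≤ b* there exist a real number ᾱ_n with |ᾱ_n| ≤ C/(ln b)² and a nonzero smooth function φ_n : (0,∞) → ℝ which belongs to L²((0,∞), ω_b(r) dr) and satisfies the eigenvalue equation (𝒜₀ − b r ∂_r) φ_n = α_n φ_n on (0,∞), where α_n = 2b(1 − n + 1/ln b + ᾱ_n). -/
open Real MeasureTheory Set

/-- `Q(r) = 4r²/(1+r²)`. -/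
noncomputable def Qfun (r : ℝ) : ℝ := 4 * r ^ 2 / (1 + r ^ 2)

/-- `U(r) = 8/(1+r²)²`. -/
noncomputable def Ufun (r : ℝ) : ℝ := 8 / (1 + r ^ 2) ^ 2

/-- The operator `𝒜₀ f = f'' − f'/r + Q f'/r + Q' f/r`. -/
noncomputable def A0 (f : ℝ → ℝ) (r : ℝ) : ℝ :=
  deriv (deriv f) r - deriv f r / r + Qfun r * deriv f r / r + deriv Qfun r * f r / r

/-- The weight `ω_b(r) = e^{−b r²/2}/(r U(r))`. -/
noncomputable def omegaB (b r : ℝ) : ℝ := Real.exp (-b * r ^ 2 / 2) / (r * Ufun r)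

section Helpers
open Filter Topology Polynomial

noncomputable def lagP : ℕ → ℝ[X]
  | 0 => 1
  | (n+1) => C (((n:ℝ)+1)⁻¹) * (X * derivative (lagP n) + (C ((n:ℝ)+1) - X) * lagP n)

lemma lagP_succ_mul (n : ℕ) : C ((n:ℝ)+1) * lagP (n+1) =
    X * derivative (lagP n) + (C ((n:ℝ)+1) - X) * lagP n := by
  have h : ((n:ℝ)+1) ≠ 0 := by positivity
  rw [lagP, ← mul_assoc, ← C_mul, mul_inv_cancel₀ h, C_1, one_mul]

lemma lagP_facts (n : ℕ) :
    (X * derivative (derivative (lagP n)) + (1 - X) * derivative (lagP n) + C (n:ℝ) * lagP n = 0) ∧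
    derivative (lagP (n+1)) = derivative (lagP n) - lagP n := by
  have key : ∀ n : ℕ, (X * derivative (derivative (lagP n)) + (1 - X) * derivative (lagP n) + C (n:ℝ) * lagP n = 0) →
    derivative (lagP (n+1)) = derivative (lagP n) - lagP n := by
    intro n h
    have h1 := congrArg derivative (lagP_succ_mul n)
    simp only [derivative_mul, derivative_add, derivative_sub, derivative_X, derivative_C] at h1
    have hC : (C ((n:ℝ)+1) : ℝ[X]) ≠ 0 := by
      rw [Ne, C_eq_zero]; positivity
    apply mul_left_cancel₀ hC
    have e : (C ((n:ℝ)+1) : ℝ[X]) = C (n:ℝ) + 1 := by simp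
    rw [e] at h1 ⊢
    linear_combination h1 + h
  have ode : ∀ n : ℕ, (X * derivative (derivative (lagP n)) + (1 - X) * derivative (lagP n) + C (n:ℝ) * lagP n = 0) := by
    intro n
    induction n with
    | zero => simp [lagP]
    | succ n ih =>
      have h1 := key n ih
      have h2 := lagP_succ_mul n
      rw [h1]
      simp only [derivative_sub]
      have e : (C ((n:ℝ)+1) : ℝ[X]) = C (n:ℝ) + 1 := by simp
      have e2 : (C (((n+1:ℕ):ℝ)) : ℝ[X]) = C (n:ℝ) + 1 := by simp
      rw [e] at h2
      rw [e2]
      linear_combination h2 + ih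
  exact ⟨ode n, key n (ode n)⟩

lemma lagP_zero_eval (n : ℕ) : (lagP n).eval 0 = 1 := by
  induction n with
  | zero => simp [lagP]
  | succ n ih =>
    have h : ((n:ℝ)+1) ≠ 0 := by positivity
    simp [lagP, ih, h]

lemma lagP_natDegree (n : ℕ) : (lagP n).natDegree ≤ n := by
  induction n with
  | zero => simp [lagP]
  | succ n ih =>
    rw [lagP]
    refine (natDegree_C_mul_le _ _).trans ?_
    apply natDegree_add_le_of_degree_le
    · refine natDegree_mul_le.trans ?_
      have := natDegree_derivative_le (lagP n)
      have : (X : ℝ[X]).natDegree ≤ 1 := natDegree_X_le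
      omega
    · refine natDegree_mul_le.trans ?_
      have : (C ((n:ℝ)+1) - X : ℝ[X]).natDegree ≤ 1 := by
        exact (natDegree_sub_le_of_le (m := 0) (n := 1) (natDegree_C _).le natDegree_X_le).trans (by simp)
      omega

lemma lagP_coeff (n : ℕ) : 0 < (-1)^n * (lagP n).coeff n := by
  induction n with
  | zero => simp [lagP]
  | succ n ih =>
    have h0 : (lagP n).coeff (n+1) = 0 := coeff_eq_zero_of_natDegree_lt (by have := lagP_natDegree n; omega)
    have : (lagP (n+1)).coeff (n+1) = - ((n:ℝ)+1)⁻¹ * (lagP n).coeff n := by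
      rw [lagP, coeff_C_mul, coeff_add, sub_mul, coeff_sub, coeff_X_mul, coeff_X_mul, coeff_C_mul, coeff_derivative, h0]
      ring
    rw [this]
    have : 0 < ((n:ℝ)+1)⁻¹ * ((-1)^n * (lagP n).coeff n) := by positivity
    calc 0 < _ := this
      _ = _ := by rw [pow_succ]; ring

lemma poly_exp_bound (p : ℝ[X]) (η : ℝ) (hη : 0 < η) :
    ∃ A : ℝ, 0 < A ∧ ∀ t : ℝ, 0 ≤ t → |p.eval t| ≤ A * exp (η * t) := by
  induction p using Polynomial.induction_on' with
  | add p q hp hq =>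
    obtain ⟨A, hA, h1⟩ := hp
    obtain ⟨B, hB, h2⟩ := hq
    refine ⟨A + B, by positivity, fun t ht => ?_⟩
    rw [eval_add, add_mul]
    exact (abs_add_le _ _).trans (add_le_add (h1 t ht) (h2 t ht))
  | monomial n a =>
    refine ⟨|a| * (n.factorial / η^n) + 1, by positivity, fun t ht => ?_⟩
    have := Real.pow_div_factorial_le_exp (η * t) (by positivity) n
    rw [eval_monomial, abs_mul, abs_of_nonneg (pow_nonneg ht n)]
    have h3 : t^n ≤ n.factorial / η^n * exp (η * t) := by
      rw [mul_pow, div_le_iff₀ (by positivity)] at this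
      rw [div_mul_eq_mul_div, le_div_iff₀ (by positivity)]
      linarith
    have h4 := exp_pos (η * t)
    nlinarith [mul_le_mul_of_nonneg_left h3 (abs_nonneg a)]

lemma poly_integrable (p : ℝ[X]) : IntegrableOn (fun t => exp (-t) * p.eval t) (Ioi 0) := by
  obtain ⟨A, hA, h⟩ := poly_exp_bound p (1/2) (by norm_num)
  refine integrable_of_isBigO_exp_neg (b := 1/2) (by norm_num) ?_ ?_
  · fun_prop
  · refine Asymptotics.IsBigO.of_bound A ?_
    filter_upwards [eventually_ge_atTop 0] with t ht
    rw [norm_mul, norm_eq_abs, norm_eq_abs, norm_eq_abs, abs_of_pos (exp_pos _), abs_of_pos (exp_pos _)]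
    have := mul_le_mul_of_nonneg_left (h t ht) (exp_pos (-t)).le
    refine this.trans (le_of_eq ?_)
    rw [mul_left_comm, ← exp_add]
    ring_nf

lemma poly_tendsto (p : ℝ[X]) : Tendsto (fun t => exp (-t) * p.eval t) atTop (𝓝 0) := by
  have := Polynomial.tendsto_div_exp_atTop p
  refine this.congr (fun t => ?_)
  rw [exp_neg]; ring

/-- integration by parts -/
lemma poly_int_deriv (p : ℝ[X]) : ∫ t in Ioi (0:ℝ), exp (-t) * (derivative p - p).eval t = - p.eval 0 := by
  have h := integral_Ioi_of_hasDerivAt_of_tendsto' (a := 0) (f := fun t => exp (-t) * p.eval t)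
    (f' := fun t => exp (-t) * (derivative p - p).eval t) (m := 0) ?_ (poly_integrable _) (poly_tendsto p)
  · rw [h]; simp
  · intro x _
    have h1 : HasDerivAt (fun t : ℝ => exp (-t)) (exp (-x) * (-1)) x := (hasDerivAt_neg x).exp
    exact (h1.mul (p.hasDerivAt x)).congr_deriv (by rw [eval_sub]; ring)

lemma lagP_orth (m n : ℕ) (h : m ≠ n) :
    ∫ t in Ioi (0:ℝ), exp (-t) * (lagP m * lagP n).eval t = 0 := by
  have h1 := (lagP_facts m).1
  have h2 := (lagP_facts n).1
  have h3 := poly_int_deriv (X * (derivative (lagP m) * lagP n - lagP m * derivative (lagP n)))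
  have h4 : derivative (X * (derivative (lagP m) * lagP n - lagP m * derivative (lagP n))) - (X * (derivative (lagP m) * lagP n - lagP m * derivative (lagP n)))
     = C ((n:ℝ) - m) * (lagP m * lagP n) := by
    simp only [derivative_mul, derivative_sub, derivative_X]
    rw [C_sub]
    linear_combination lagP n * h1 - lagP m * h2
  rw [h4] at h3
  simp only [eval_mul, eval_C, eval_X, zero_mul, neg_zero] at h3 ⊢
  have h5 : ∀ t : ℝ, exp (-t) * (((n:ℝ) - m) * (eval t (lagP m) * eval t (lagP n))) = ((n:ℝ) - m) * (exp (-t) * (eval t (lagP m) * eval t (lagP n))) := fun t => by ring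
  simp only [h5] at h3
  rw [integral_const_mul] at h3
  rcases mul_eq_zero.1 h3 with h6 | h6
  · exfalso; apply h
    have : (n:ℝ) = m := by linarith
    exact_mod_cast this.symm
  · exact h6

lemma lagP_orth_deriv (n m : ℕ) (h : m ≤ n) :
    ∫ t in Ioi (0:ℝ), exp (-t) * (lagP n * derivative (lagP m)).eval t = 0 := by
  induction m with
  | zero => simp [lagP]
  | succ m ih =>
    rw [(lagP_facts m).2]
    have e : ∀ t : ℝ, exp (-t) * eval t (lagP n * (derivative (lagP m) - lagP m)) =
      exp (-t) * eval t (lagP n * derivative (lagP m)) - exp (-t) * eval t (lagP n * lagP m) := by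
      intro t; simp only [eval_mul, eval_sub]; ring
    simp only [e]
    rw [integral_sub (poly_integrable _) (poly_integrable _), ih (by omega), lagP_orth n m (by omega), sub_zero]

lemma lagP_norm (n : ℕ) : ∫ t in Ioi (0:ℝ), exp (-t) * ((lagP n).eval t)^2 = 1 := by
  have h1 := poly_int_deriv (lagP n ^ 2)
  have h2 := lagP_orth_deriv n n le_rfl
  have e : ∀ t : ℝ, exp (-t) * eval t (derivative (lagP n ^ 2) - lagP n ^ 2) =
      2 * (exp (-t) * eval t (lagP n * derivative (lagP n))) - exp (-t) * eval t (lagP n ^ 2) := by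
    intro t; simp only [eval_mul, eval_sub, eval_pow, derivative_pow, eval_C]; norm_num; ring
  simp only [e] at h1
  rw [integral_sub ((poly_integrable _).const_mul _) (poly_integrable _), integral_const_mul, h2] at h1
  simp only [eval_pow, lagP_zero_eval] at h1
  linarith

lemma poly_eventually_pos (p : ℝ[X]) (n : ℕ) (hd : p.natDegree ≤ n) (hc : 0 < p.coeff n) :
    ∀ᶠ t in atTop, 0 < p.eval t := by
  have hn : p.natDegree = n := le_antisymm hd (le_natDegree_of_ne_zero hc.ne')
  have hl : p.leadingCoeff = p.coeff n := by rw [leadingCoeff, hn]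
  rcases Nat.eq_zero_or_pos n with h | h
  · subst h
    rw [eq_C_of_natDegree_eq_zero hn]
    simp only [eval_C]
    exact Eventually.of_forall fun _ => hc
  · have := p.tendsto_atTop_of_leadingCoeff_nonneg (natDegree_pos_iff_degree_pos.1 (by omega)) (by rw [hl]; exact hc.le)
    exact this.eventually_gt_atTop 0

lemma lagP_eventually (n : ℕ) : ∃ R : ℝ, ∀ t, R ≤ t →
    1 ≤ (-1)^n * (lagP n).eval t ∧ 0 ≤ (-1)^n * (derivative (lagP n)).eval t ∧
    (-1)^n * (derivative (lagP n)).eval t ≤ (-1)^n * (lagP n).eval t := by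
  rcases Nat.eq_zero_or_pos n with h | h
  · subst h; exact ⟨0, fun t _ => by simp [lagP]⟩
  have hc := lagP_coeff n
  have hdeg := lagP_natDegree n
  have hcn : ((C ((-1)^n) * lagP n : ℝ[X])).coeff n = (-1)^n * (lagP n).coeff n := by rw [coeff_C_mul]
  have h1 : ∀ᶠ t in atTop, 0 < (C ((-1)^n) * lagP n - 1 : ℝ[X]).eval t := by
    apply poly_eventually_pos _ n
    · exact (natDegree_sub_le_of_le (m := n) (n := 0) ((natDegree_C_mul_le _ _).trans hdeg) natDegree_one.le).trans (by simp)
    · rw [coeff_sub, hcn, coeff_one, if_neg (by omega)]; linarith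
  have h2 : ∀ᶠ t in atTop, 0 < (C ((-1)^n) * derivative (lagP n) : ℝ[X]).eval t := by
    apply poly_eventually_pos _ (n-1)
    · refine (natDegree_C_mul_le _ _).trans ((natDegree_derivative_le _).trans (by omega))
    · rw [coeff_C_mul, coeff_derivative, Nat.sub_add_cancel h, ← mul_assoc]
      positivity
  have h3 : ∀ᶠ t in atTop, 0 < (C ((-1)^n) * lagP n - C ((-1)^n) * derivative (lagP n) : ℝ[X]).eval t := by
    have hdd : (C ((-1)^n) * derivative (lagP n) : ℝ[X]).natDegree ≤ n - 1 :=
      (natDegree_C_mul_le _ _).trans ((natDegree_derivative_le _).trans (by omega))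
    apply poly_eventually_pos _ n
    · exact (natDegree_sub_le_of_le (m := n) (n := n - 1) ((natDegree_C_mul_le _ _).trans hdeg) hdd).trans (by simp)
    · rw [coeff_sub, hcn, coeff_eq_zero_of_natDegree_lt (n := n) (p := C ((-1)^n) * derivative (lagP n)) (by omega)]; linarith
  obtain ⟨R, hR⟩ := eventually_atTop.1 (h1.and (h2.and h3))
  refine ⟨R, fun t ht => ?_⟩
  obtain ⟨a, b, c⟩ := hR t ht
  simp only [eval_sub, eval_mul, eval_C, eval_one] at a b c
  exact ⟨by linarith, by linarith, by linarith⟩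

lemma ii_of_bdd {f : ℝ → ℝ} {s B : ℝ} (hs : 0 ≤ s) (hc : ContinuousOn f (Ioi 0))
    (hb : ∀ t, 0 < t → t ≤ s → |f t| ≤ B) : IntervalIntegrable f volume 0 s := by
  rw [intervalIntegrable_iff_integrableOn_Ioc_of_le hs]
  refine Integrable.of_bound ?_ B ?_
  · exact (hc.mono Ioc_subset_Ioi_self).aestronglyMeasurable measurableSet_Ioc
  · rw [ae_restrict_iff' measurableSet_Ioc]
    exact Eventually.of_forall fun t ht => hb t ht.1 ht.2

lemma hasDeriv_prim {f : ℝ → ℝ} {s : ℝ} (hs : 0 < s) (hc : ContinuousOn f (Ioi 0))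
    (hi : IntervalIntegrable f volume 0 s) : HasDerivAt (fun z => ∫ t in (0:ℝ)..z, f t) (f s) s :=
  intervalIntegral.integral_hasDerivAt_right hi
    (hc.stronglyMeasurableAtFilter isOpen_Ioi _ hs) (hc.continuousAt (isOpen_Ioi.mem_nhds hs))

noncomputable def vIn (g : ℝ → ℝ) (s : ℝ) : ℝ := ∫ t in (0:ℝ)..s, exp (-t) * g t
noncomputable def vOut (β : ℝ) (g : ℝ → ℝ) (z : ℝ) : ℝ :=
  ∫ s in (0:ℝ)..z, exp s * (s/(s+β)^2) * vIn g s

lemma integral_exp_mul_aux {c z : ℝ} (hc : 0 < c) :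
    ∫ s in (0:ℝ)..z, exp (c * s) = (exp (c * z) - exp (c * 0)) / c := by
  have : ∀ s ∈ uIcc 0 z, HasDerivAt (fun s => exp (c * s) / c) (exp (c * s)) s := by
    intro s _
    have := (((hasDerivAt_id s).const_mul c).exp).div_const c
    refine this.congr_deriv ?_
    simp only [id]
    field_simp
  rw [intervalIntegral.integral_eq_sub_of_hasDerivAt this (by apply Continuous.intervalIntegrable; fun_prop)]
  ring

structure GB (lam N : ℝ) (g : ℝ → ℝ) : Prop where
  c : ContinuousOn g (Ioi 0)
  b : ∀ t, 0 < t → |g t| ≤ N * exp (lam * t)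

section
variable {lam N β : ℝ} {g : ℝ → ℝ}

lemma GB.N_nonneg (h : GB lam N g) : 0 ≤ N := by
  have := (abs_nonneg _).trans (h.b 1 one_pos)
  exact nonneg_of_mul_nonneg_left this (exp_pos _)

lemma GB.ii (hl : 1 ≤ lam) (h : GB lam N g) {s : ℝ} (hs : 0 ≤ s) :
    IntervalIntegrable (fun t => exp (-t) * g t) volume 0 s := by
  have hN := h.N_nonneg
  refine ii_of_bdd (B := N * exp ((lam) * s)) hs (by have := h.c; fun_prop) ?_
  intro t ht hts
  rw [abs_mul, abs_of_pos (exp_pos _)]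
  have h1 : exp (-t) ≤ 1 := by rw [exp_le_one_iff]; linarith
  have h2 : exp (lam * t) ≤ exp (lam * s) := exp_le_exp.2 (by nlinarith)
  calc exp (-t) * |g t| ≤ 1 * |g t| := by gcongr
    _ ≤ N * exp (lam * t) := by rw [one_mul]; exact h.b t ht
    _ ≤ _ := by gcongr

lemma GB.in_deriv (hl : 1 ≤ lam) (h : GB lam N g) {s : ℝ} (hs : 0 < s) :
    HasDerivAt (vIn g) (exp (-s) * g s) s :=
  hasDeriv_prim hs (by have := h.c; fun_prop) (h.ii hl hs.le)

lemma GB.in_bound (hl : 1 ≤ lam) (h : GB lam N g) {s : ℝ} (hs : 0 < s) :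
    |vIn g s| ≤ N * s * exp ((lam - 1) * s) := by
  have hN := h.N_nonneg
  have := intervalIntegral.norm_integral_le_of_norm_le_const (a := 0) (b := s) (f := fun t => exp (-t) * g t)
    (C := N * exp ((lam-1) * s)) ?_
  · rw [norm_eq_abs] at this
    rw [sub_zero, abs_of_pos hs] at this
    rw [vIn]; linarith
  · intro t ht
    rw [uIoc_of_le hs.le] at ht
    rw [norm_eq_abs, abs_mul, abs_of_pos (exp_pos _)]
    calc exp (-t) * |g t| ≤ exp (-t) * (N * exp (lam * t)) := by gcongr; exact h.b t ht.1
      _ = N * exp ((lam - 1) * t) := by rw [mul_left_comm, ← exp_add]; ring_nf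
      _ ≤ _ := by
        gcongr
        exact ht.2

lemma q_mono (hβ : 0 < β) {s z : ℝ} (hs : 0 < s) (hz : s ≤ z) : (s/(s+β))^2 ≤ (z/(z+β))^2 := by
  have : 0 < z := by linarith
  gcongr ?_ ^ 2
  rw [div_le_div_iff₀ (by linarith) (by linarith)]
  nlinarith

lemma GB.outI_bound (hβ : 0 < β) (hl : 1 ≤ lam) (h : GB lam N g) {s z : ℝ} (hs : 0 < s) (hz : s ≤ z) :
    |exp s * (s/(s+β)^2) * vIn g s| ≤ N * (z/(z+β))^2 * exp (lam * s) := by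
  have hN := h.N_nonneg
  rw [abs_mul, abs_of_pos (by positivity)]
  calc exp s * (s/(s+β)^2) * |vIn g s| ≤ exp s * (s/(s+β)^2) * (N * s * exp ((lam - 1) * s)) := by
        gcongr; exact h.in_bound hl hs
    _ = N * (s/(s+β))^2 * (exp s * exp ((lam - 1) * s)) := by rw [div_pow]; ring
    _ = N * (s/(s+β))^2 * (exp (lam * s)) := by rw [← exp_add]; ring_nf
    _ ≤ _ := by
      have := q_mono hβ hs hz
      gcongr

lemma GB.outI_cont (hβ : 0 < β) (hl : 1 ≤ lam) (h : GB lam N g) :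
    ContinuousOn (fun s => exp s * (s/(s+β)^2) * vIn g s) (Ioi 0) := by
  have h1 : ContinuousOn (vIn g) (Ioi 0) := fun s hs => (h.in_deriv hl hs).continuousAt.continuousWithinAt
  have h2 : ContinuousOn (fun s => s/(s+β)^2) (Ioi 0) := by
    refine ContinuousOn.div (by fun_prop) (by fun_prop) ?_
    intro x hx
    have : 0 < x + β := add_pos hx hβ
    positivity
  fun_prop

lemma GB.outI_ii (hβ : 0 < β) (hl : 1 ≤ lam) (h : GB lam N g) {z : ℝ} (hz : 0 ≤ z) :
    IntervalIntegrable (fun s => exp s * (s/(s+β)^2) * vIn g s) volume 0 z := by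
  have hN := h.N_nonneg
  refine ii_of_bdd (B := N * (z/(z+β))^2 * exp (lam * z)) hz (h.outI_cont hβ hl) ?_
  intro t ht htz
  refine (h.outI_bound hβ hl ht htz).trans ?_
  gcongr

lemma GB.out_deriv (hβ : 0 < β) (hl : 1 ≤ lam) (h : GB lam N g) {z : ℝ} (hz : 0 < z) :
    HasDerivAt (vOut β g) (exp z * (z/(z+β)^2) * vIn g z) z :=
  hasDeriv_prim hz (h.outI_cont hβ hl) (h.outI_ii hβ hl hz.le)

lemma GB.out_bound (hβ : 0 < β) (hl : 1 ≤ lam) (h : GB lam N g) {z : ℝ} (hz : 0 < z) :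
    |vOut β g z| ≤ N / lam * (z/(z+β))^2 * exp (lam * z) := by
  have hN := h.N_nonneg
  have h1 := intervalIntegral.norm_integral_le_of_norm_le (a := 0) (b := z) (μ := volume)
    (f := fun s => exp s * (s/(s+β)^2) * vIn g s)
    (g := fun s => N * (z/(z+β))^2 * exp (lam * s)) hz.le
    (Eventually.of_forall fun t ht => h.outI_bound hβ hl ht.1 ht.2)
    (by apply Continuous.intervalIntegrable; fun_prop)
  rw [norm_eq_abs] at h1
  refine h1.trans ?_
  rw [intervalIntegral.integral_const_mul, integral_exp_mul_aux (by linarith)]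
  have h3 : (exp (lam * z) - exp (lam * 0)) / lam ≤ exp (lam * z) / lam := by
    gcongr
    linarith [exp_pos (lam * 0)]
  calc _ ≤ N * (z/(z+β))^2 * (exp (lam * z) / lam) := by gcongr
    _ = _ := by ring

end

abbrev EE := BoundedContinuousFunction (Ioi (0:ℝ)) ℝ

noncomputable def lft (lam : ℝ) (g : EE) (t : ℝ) : ℝ :=
  if h : 0 < t then exp (lam * t) * g ⟨t, h⟩ else 0

lemma lft_pos (lam : ℝ) (g : EE) {t : ℝ} (h : 0 < t) : lft lam g t = exp (lam * t) * g ⟨t, h⟩ := by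
  simp [lft, h]

lemma lft_GB (lam : ℝ) (g : EE) : GB lam ‖g‖ (lft lam g) := by
  constructor
  · rw [continuousOn_iff_continuous_domRestrict]
    have : (Ioi (0:ℝ)).domRestrict (lft lam g) = fun x : Ioi (0:ℝ) => exp (lam * x) * g x := by
      funext x
      rw [domRestrict_apply, lft_pos lam g x.2]
    rw [this]
    have := g.continuous
    fun_prop
  · intro t ht
    rw [lft_pos lam g ht, abs_mul, abs_of_pos (exp_pos _), mul_comm]
    gcongr
    exact g.norm_coe_le_norm _

noncomputable def mkB (lam N : ℝ) (f : ℝ → ℝ) (h : GB lam N f) : EE :=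
  BoundedContinuousFunction.ofNormedAddCommGroup (fun x : Ioi (0:ℝ) => exp (-(lam * x)) * f x)
    (by
      have := continuousOn_iff_continuous_domRestrict.1 h.c
      have h2 : Continuous (fun x : Ioi (0:ℝ) => f x) := this
      exact Continuous.mul (by fun_prop) h2) N
    (by
      intro x
      have := h.b x x.2
      rw [norm_eq_abs, abs_mul, abs_of_pos (exp_pos _)]
      calc _ ≤ exp (-(lam * x)) * (N * exp (lam * x)) := by gcongr
        _ = N := by rw [mul_left_comm, ← exp_add]; simp)

lemma mkB_apply (lam N : ℝ) (f : ℝ → ℝ) (h : GB lam N f) (x : Ioi (0:ℝ)) :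
    mkB lam N f h x = exp (-(lam * x)) * f x := rfl

lemma mkB_norm (lam N : ℝ) (f : ℝ → ℝ) (h : GB lam N f) : ‖mkB lam N f h‖ ≤ N :=
  BoundedContinuousFunction.norm_ofNormedAddCommGroup_le _ h.N_nonneg _

lemma lft_mkB (lam N : ℝ) (f : ℝ → ℝ) (h : GB lam N f) {t : ℝ} (ht : 0 < t) :
    lft lam (mkB lam N f h) t = f t := by
  rw [lft_pos _ _ ht, mkB_apply, ← mul_assoc, ← exp_add]; simp

lemma lft_add (lam : ℝ) (g g' : EE) (t : ℝ) : lft lam (g + g') t = lft lam g t + lft lam g' t := by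
  by_cases h : 0 < t
  · simp [lft, h]; ring
  · simp [lft, h]

lemma lft_smul (lam c : ℝ) (g : EE) (t : ℝ) : lft lam (c • g) t = c * lft lam g t := by
  by_cases h : 0 < t
  · simp [lft, h]; ring
  · simp [lft, h]

lemma vIn_add {lam : ℝ} (hl : 1 ≤ lam) (g g' : EE) {s : ℝ} (hs : 0 ≤ s) :
    vIn (lft lam (g + g')) s = vIn (lft lam g) s + vIn (lft lam g') s := by
  rw [vIn, vIn, vIn, ← intervalIntegral.integral_add ((lft_GB lam g).ii hl hs) ((lft_GB lam g').ii hl hs)]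
  congr 1; funext t; rw [lft_add]; ring

lemma vIn_smul {lam : ℝ} (c : ℝ) (g : EE) {s : ℝ} :
    vIn (lft lam (c • g)) s = c * vIn (lft lam g) s := by
  rw [vIn, vIn, ← intervalIntegral.integral_const_mul]
  congr 1; funext t; rw [lft_smul]; ring

lemma vOut_add {β lam : ℝ} (hβ : 0 < β) (hl : 1 ≤ lam) (g g' : EE) {s : ℝ} (hs : 0 ≤ s) :
    vOut β (lft lam (g + g')) s = vOut β (lft lam g) s + vOut β (lft lam g') s := by
  rw [vOut, vOut, vOut, ← intervalIntegral.integral_add ((lft_GB lam g).outI_ii hβ hl hs) ((lft_GB lam g').outI_ii hβ hl hs)]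
  refine intervalIntegral.integral_congr fun t ht => ?_
  rw [uIcc_of_le hs] at ht
  rw [vIn_add hl _ _ ht.1]; ring

lemma vOut_smul {β lam : ℝ} (c : ℝ) (g : EE) {s : ℝ} :
    vOut β (lft lam (c • g)) s = c * vOut β (lft lam g) s := by
  rw [vOut, vOut, ← intervalIntegral.integral_const_mul]
  congr 1; funext t; rw [vIn_smul]; ring

lemma T_GB {β lam : ℝ} (hβ : 0 < β) (hl : 1 ≤ lam) (g : EE) :
    GB lam (‖g‖ / lam) (fun z => ((z/(z+β))^2)⁻¹ * vOut β (lft lam g) z) := by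
  constructor
  · have h1 : ContinuousOn (vOut β (lft lam g)) (Ioi 0) :=
      fun s hs => ((lft_GB lam g).out_deriv hβ hl hs).continuousAt.continuousWithinAt
    refine ContinuousOn.mul ?_ h1
    refine ContinuousOn.inv₀ ?_ ?_
    · refine ContinuousOn.pow (ContinuousOn.div (by fun_prop) (by fun_prop) ?_) 2
      intro x hx
      have : 0 < x + β := add_pos hx hβ
      positivity
    · intro x hx
      have hx' : 0 < x := hx
      have : 0 < x + β := add_pos hx hβ
      positivity
  · intro z hz
    have h1 := (lft_GB lam g).out_bound hβ hl hz
    have h2 : 0 < (z/(z+β))^2 := by positivity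
    rw [abs_mul, abs_of_pos (by positivity : 0 < ((z/(z+β))^2)⁻¹), inv_mul_le_iff₀ h2]
    linarith

noncomputable def TT (β lam : ℝ) (hβ : 0 < β) (hl : 1 ≤ lam) : EE →L[ℝ] EE :=
  LinearMap.mkContinuous
    { toFun := fun g => mkB lam (‖g‖ / lam) _ (T_GB hβ hl g)
      map_add' := by
        intro g g'
        ext x
        rw [BoundedContinuousFunction.add_apply, mkB_apply, mkB_apply, mkB_apply, vOut_add hβ hl g g' (le_of_lt x.2)]
        ring
      map_smul' := by
        intro c g
        ext x
        simp only [RingHom.id_apply]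
        rw [BoundedContinuousFunction.smul_apply, mkB_apply, mkB_apply, vOut_smul, smul_eq_mul]
        ring } (1/lam)
    (by
      intro g
      refine (mkB_norm _ _ _ _).trans (le_of_eq ?_)
      ring)

lemma TT_norm (β lam : ℝ) (hβ : 0 < β) (hl : 1 ≤ lam) : ‖TT β lam hβ hl‖ ≤ 1/lam :=
  LinearMap.mkContinuous_norm_le _ (by positivity) _

lemma TT_lft (β lam : ℝ) (hβ : 0 < β) (hl : 1 ≤ lam) (g : EE) {z : ℝ} (hz : 0 < z) :
    lft lam (TT β lam hβ hl g) z = ((z/(z+β))^2)⁻¹ * vOut β (lft lam g) z :=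
  lft_mkB lam _ _ (T_GB hβ hl g) hz

/-- abstract solve -/
lemma abstract_solve {E : Type*} [NormedAddCommGroup E] [NormedSpace ℝ E] [CompleteSpace E]
    (T : E →L[ℝ] E) (ν₀ K : ℝ) (hν : 0 ≤ ν₀) (hT : (ν₀ + K) * ‖T‖ ≤ 1/2) (f0 f1 : E) :
    ∃ g : ℝ → E, ContinuousOn g (Icc 0 K) ∧ ∀ δ ∈ Icc 0 K,
      g δ = - T ((ν₀ + δ) • g δ + (f0 + δ • f1)) ∧ ‖g δ‖ ≤ 2 * ‖T‖ * ‖f0 + δ • f1‖ := by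
  have hn : ∀ δ ∈ Icc 0 K, ‖-((ν₀ + δ) • T)‖ ≤ 1/2 := by
    intro δ hδ
    rw [norm_neg, norm_smul, norm_eq_abs, abs_of_nonneg (by linarith [hδ.1])]
    refine le_trans ?_ hT
    gcongr
    exact hδ.2
  have hu : ∀ δ ∈ Icc 0 K, IsUnit (1 + (ν₀ + δ) • T) := by
    intro δ hδ
    have := (Units.oneSub (-((ν₀ + δ) • T)) (by linarith [hn δ hδ])).isUnit
    rwa [Units.val_oneSub, sub_neg_eq_add] at this
  refine ⟨fun δ => - (Ring.inverse (1 + (ν₀ + δ) • T)) (T (f0 + δ • f1)), ?_, ?_⟩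
  · intro δ hδ
    obtain ⟨u, hu⟩ := hu δ hδ
    have h1 : ContinuousAt (fun δ => Ring.inverse (1 + (ν₀ + δ) • T)) δ := by
      have h2 := NormedRing.inverse_continuousAt u
      rw [hu] at h2
      exact ContinuousAt.comp (f := fun δ : ℝ => (1 + (ν₀ + δ) • T)) (g := Ring.inverse) h2 (by fun_prop)
    refine ContinuousAt.continuousWithinAt ?_
    fun_prop
  · intro δ hδ
    set g := - (Ring.inverse (1 + (ν₀ + δ) • T)) (T (f0 + δ • f1)) with hg
    have h1 : g = - T ((ν₀ + δ) • g + (f0 + δ • f1)) := by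
      have h2 := Ring.mul_inverse_cancel _ (hu δ hδ)
      have h3 := congrArg (fun A : E →L[ℝ] E => A (T (f0 + δ • f1))) h2
      simp only [mul_apply_eq_comp, one_apply_eq_self, _root_.add_apply,
        _root_.smul_apply] at h3
      have h4 : (Ring.inverse (1 + (ν₀ + δ) • T)) (T (f0 + δ • f1)) = -g := by rw [hg, neg_neg]
      rw [h4] at h3
      rw [map_add, map_smul, ← h3]
      simp
    refine ⟨h1, ?_⟩
    have h5 : ‖g‖ ≤ ‖T‖ * ((ν₀ + δ) * ‖g‖ + ‖f0 + δ • f1‖) := by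
      calc ‖g‖ = ‖T ((ν₀ + δ) • g + (f0 + δ • f1))‖ := by rw [← norm_neg (T _), ← h1]
        _ ≤ ‖T‖ * ‖(ν₀ + δ) • g + (f0 + δ • f1)‖ := T.le_opNorm _
        _ ≤ _ := by
          gcongr
          refine (norm_add_le _ _).trans ?_
          rw [norm_smul, norm_eq_abs, abs_of_nonneg (by linarith [hδ.1])]
    have h6 : (ν₀ + δ) * ‖T‖ ≤ 1/2 := le_trans (by gcongr; exact hδ.2) hT
    have := norm_nonneg g
    nlinarith

noncomputable def ell (β z : ℝ) : ℝ := log (1 + z/β) - z/(z+β)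

section
variable {β z : ℝ}

lemma ell_deriv (hβ : 0 < β) (hz : 0 < z) : HasDerivAt (ell β) (z/(z+β)^2) z := by
  have h1 : HasDerivAt (fun z : ℝ => 1 + z/β) (1/β) z := ((hasDerivAt_id z).div_const β).const_add 1
  have hp : 0 < 1 + z/β := by positivity
  have h2 := h1.log hp.ne'
  have h3 : HasDerivAt (fun z : ℝ => z/(z+β)) ((1 * (z+β) - z * 1)/(z+β)^2) z :=
    (hasDerivAt_id z).div ((hasDerivAt_id z).add_const β) (add_pos hz hβ).ne'
  refine (h2.sub h3).congr_deriv ?_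
  field_simp
  ring

lemma ell_upper (hβ : 0 < β) (hz : 0 < z) : ((z/(z+β))^2)⁻¹ * ell β z ≤ 1 + log (1 + z/β) := by
  have hp : 0 < z/β := by positivity
  have h1 : log (1 + z/β) ≤ z/β := by
    have := log_le_sub_one_of_pos (by positivity : 0 < 1 + z/β); linarith
  rw [inv_mul_le_iff₀ (by positivity), ell]
  set l := log (1 + z/β)
  have h2 : β * l ≤ z := by rw [le_div_iff₀ hβ] at h1; linarith
  rw [div_pow, div_mul_eq_mul_div, le_div_iff₀ (by positivity)]
  have h3 : (l - z/(z+β)) * (z+β)^2 = l * (z+β)^2 - z * (z+β) := by field_simp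
  rw [h3]
  nlinarith [mul_nonneg (by positivity : 0 ≤ 2*z + β) (sub_nonneg.2 h2)]

lemma ell_lower (hβ : 0 < β) (hz : 0 < z) : log z - log β - 1 ≤ ell β z := by
  rw [ell]
  have h1 : z/(z+β) ≤ 1 := by rw [div_le_one (by positivity)]; linarith
  have h2 : log (z/β) ≤ log (1 + z/β) := log_le_log (by positivity) (by linarith)
  rw [log_div hz.ne' hβ.ne'] at h2
  linarith

lemma ell_nonneg (hβ : 0 < β) (hz : 0 < z) : 0 ≤ ell β z := by
  rw [ell]
  have := one_sub_inv_le_log_of_pos (by positivity : 0 < 1 + z/β)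
  have h : 1 - (1+z/β)⁻¹ = z/(z+β) := by field_simp; ring
  linarith

lemma log_upper (hβ : 0 < β) (hβ1 : β ≤ 1) (hz : 0 < z) : log (1 + z/β) ≤ - log β + z := by
  have h1 : 1 + z/β = (β + z)/β := by field_simp
  rw [h1, log_div (by positivity) hβ.ne']
  have := log_le_sub_one_of_pos (by positivity : 0 < β + z)
  linarith

lemma kap_log (hβ : 0 < β) (hz : 0 < z) : 2*β/(z+β) * (1 + log (1 + z/β)) ≤ 2 := by
  have h1 : log (1 + z/β) ≤ z/β := by
    have := log_le_sub_one_of_pos (by positivity : 0 < 1 + z/β); linarith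
  calc 2*β/(z+β) * (1 + log (1 + z/β)) ≤ 2*β/(z+β) * (1 + z/β) := by gcongr
    _ = 2 := by field_simp; ring
end

lemma exists_sol (n : ℕ) : ∃ C0 lam : ℝ, 0 < C0 ∧ 1 ≤ lam ∧ ∀ β : ℝ, 0 < β → 1 ≤ -log β →
    ∃ W y : ℝ → ℝ → ℝ, (∀ z, 0 < z → ContinuousOn (fun δ => W δ z) (Icc 0 (2/(-log β)))) ∧
      ∀ δ ∈ Icc 0 (2/(-log β)),
        (∀ z, 0 < z → HasDerivAt (W δ) (exp z * (z/(z+β)^2) * y δ z) z) ∧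
        (∀ z, 0 < z → HasDerivAt (y δ) (-((n+δ) * (((z/(z+β))^2)⁻¹ * exp (-z) * W δ z))) z) ∧
        Tendsto (y δ) (𝓝[>] 0) (𝓝 1) ∧
        ∀ z, 0 < z → |W δ z - ell β z * (lagP n).eval z| ≤ C0 * (z/(z+β))^2 * exp (lam * z) := by
  obtain ⟨A1, hA1, hP⟩ := poly_exp_bound (lagP n) 1 one_pos
  obtain ⟨A2, hA2, hP1⟩ := poly_exp_bound (derivative (lagP n)) 1 one_pos
  obtain ⟨A, hA, hP, hP1⟩ : ∃ A : ℝ, 0 < A ∧ (∀ t : ℝ, 0 ≤ t → |(lagP n).eval t| ≤ A * exp t) ∧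
      (∀ t : ℝ, 0 ≤ t → |(derivative (lagP n)).eval t| ≤ A * exp t) := by
    refine ⟨A1 + A2, by positivity, fun t ht => (hP t ht).trans ?_, fun t ht => (hP1 t ht).trans ?_⟩
    · rw [one_mul]; gcongr; linarith
    · rw [one_mul]; gcongr; linarith
  set lam : ℝ := 2 * (n + 2) with hlam
  have hn0 : (0:ℝ) ≤ n := Nat.cast_nonneg n
  have hl4 : 4 ≤ lam := by linarith
  have hl : 1 ≤ lam := by linarith
  refine ⟨9 * A, lam, by positivity, hl, ?_⟩
  intro β hβ hL
  set L := -log β with hLdef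
  have hβ1 : β ≤ 1 := by
    by_contra h; push Not at h
    have := log_pos h; linarith
  have hlc : ContinuousOn (ell β) (Ioi 0) := fun z hz => (ell_deriv hβ hz).continuousAt.continuousWithinAt
  have hqc : ContinuousOn (fun z : ℝ => ((z/(z+β))^2)⁻¹) (Ioi 0) := by
    refine ContinuousOn.inv₀ ?_ ?_
    · refine ContinuousOn.pow (ContinuousOn.div (by fun_prop) (by fun_prop) ?_) 2
      intro x hx
      have : 0 < x + β := add_pos hx hβ
      positivity
    · intro x hx
      have hx' : 0 < x := hx
      have : 0 < x + β := add_pos hx hβ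
      positivity
  have hkc : ContinuousOn (fun z : ℝ => 2*β/(z+β)) (Ioi 0) := by
    refine ContinuousOn.div (by fun_prop) (by fun_prop) ?_
    intro x hx
    have : 0 < x + β := add_pos hx hβ
    positivity
  have hqe : ∀ z : ℝ, 0 < z → 0 ≤ ((z/(z+β))^2)⁻¹ * ell β z := fun z hz =>
    mul_nonneg (by positivity) (ell_nonneg hβ hz)
  have hee : ∀ z : ℝ, 0 < z → exp z ≤ exp (lam * z) := fun z hz => exp_le_exp.2 (by nlinarith)
  have G0 : GB lam (5 * A) (fun z => 2 * (derivative (lagP n)).eval z - (lagP n).eval z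
      - ((z/(z+β))^2)⁻¹ * ell β z * (2*β/(z+β)) * (derivative (lagP n)).eval z) := by
    constructor
    · have h1 : ContinuousOn (fun z => (lagP n).eval z) (Ioi 0) := by fun_prop
      have h2 : ContinuousOn (fun z => (derivative (lagP n)).eval z) (Ioi 0) := by fun_prop
      exact ((h2.const_mul 2).sub h1).sub (((hqc.mul hlc).mul hkc).mul h2)
    · intro z hz
      have h1 := hP z hz.le
      have h2 := hP1 z hz.le
      have h3 : ((z/(z+β))^2)⁻¹ * ell β z * (2*β/(z+β)) ≤ 2 := by
        refine le_trans ?_ (kap_log hβ hz)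
        rw [mul_comm]
        have := ell_upper hβ hz
        gcongr
      have h4 : 0 ≤ ((z/(z+β))^2)⁻¹ * ell β z * (2*β/(z+β)) := mul_nonneg (hqe z hz) (by positivity)
      have h5 : |((z/(z+β))^2)⁻¹ * ell β z * (2*β/(z+β)) * (derivative (lagP n)).eval z| ≤ 2 * (A * exp z) := by
        rw [abs_mul, abs_of_nonneg h4]
        gcongr
      have h6 : |2 * (derivative (lagP n)).eval z| ≤ 2 * (A * exp z) := by
        rw [abs_mul, abs_two]; gcongr
      have h7 := abs_sub (2 * (derivative (lagP n)).eval z - (lagP n).eval z) (((z/(z+β))^2)⁻¹ * ell β z * (2*β/(z+β)) * (derivative (lagP n)).eval z)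
      have h8 := abs_sub (2 * (derivative (lagP n)).eval z) ((lagP n).eval z)
      have h9 := mul_le_mul_of_nonneg_left (hee z hz) (by positivity : 0 ≤ 5 * A)
      linarith
  have G1 : GB lam ((1 + L) * A) (fun z => ((z/(z+β))^2)⁻¹ * ell β z * (lagP n).eval z) := by
    constructor
    · have h1 : ContinuousOn (fun z => (lagP n).eval z) (Ioi 0) := by fun_prop
      exact (hqc.mul hlc).mul h1
    · intro z hz
      have h1 := hP z hz.le
      rw [abs_mul, abs_of_nonneg (hqe z hz)]
      have h2 : ((z/(z+β))^2)⁻¹ * ell β z ≤ (1 + L) * exp z := by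
        have a := ell_upper hβ hz
        have b := log_upper hβ hβ1 hz
        have c := add_one_le_exp z
        nlinarith
      calc _ ≤ ((1 + L) * exp z) * (A * exp z) := by gcongr
        _ = (1+L) * A * exp (2 * z) := by rw [two_mul, exp_add]; ring
        _ ≤ _ := by gcongr; linarith
  set f0 : EE := mkB lam _ _ G0 with hf0
  set f1 : EE := mkB lam _ _ G1 with hf1
  have hK2 : 2 / L ≤ 2 := by rw [div_le_iff₀ (by linarith)]; linarith
  have hTn := TT_norm β lam hβ hl
  obtain ⟨g, hgc, hg⟩ := abstract_solve (TT β lam hβ hl) (n:ℝ) (2/L) hn0 (by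
    have h0 : (0:ℝ) ≤ n + 2/L := by positivity
    calc ((n:ℝ) + 2/L) * ‖TT β lam hβ hl‖ ≤ (n + 2) * (1/lam) := by gcongr
      _ = 1/2 := by rw [hlam]; field_simp) f0 f1
  set GG : ℝ → EE := fun δ => -(((n:ℝ) + δ) • g δ + (f0 + δ • f1)) with hGG
  have hout : ∀ δ ∈ Icc 0 (2/L), ∀ z, 0 < z → vOut β (lft lam (GG δ)) z = (z/(z+β))^2 * lft lam (g δ) z := by
    intro δ hδ z hz
    have h1 := TT_lft β lam hβ hl (GG δ) hz
    have h2 : TT β lam hβ hl (GG δ) = g δ := by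
      rw [hGG]; simp only [map_neg]; exact (hg δ hδ).1.symm
    rw [h2] at h1
    rw [h1, ← mul_assoc, mul_inv_cancel₀ (by positivity), one_mul]
  have hGv : ∀ δ, ∀ z, 0 < z → lft lam (GG δ) z = -(((n:ℝ)+δ) * lft lam (g δ) z +
      (2 * (derivative (lagP n)).eval z - (lagP n).eval z
      - ((z/(z+β))^2)⁻¹ * ell β z * (2*β/(z+β)) * (derivative (lagP n)).eval z + δ * (((z/(z+β))^2)⁻¹ * ell β z * (lagP n).eval z))) := by
    intro δ z hz
    have e : GG δ = (-1 : ℝ) • (((n:ℝ) + δ) • g δ + (f0 + δ • f1)) := (neg_one_smul ℝ _).symm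
    rw [e, lft_smul, lft_add, lft_add, lft_smul, lft_smul, hf0, hf1, lft_mkB _ _ _ _ hz, lft_mkB _ _ _ _ hz]
    ring
  refine ⟨fun δ z => ell β z * (lagP n).eval z + vOut β (lft lam (GG δ)) z,
    fun δ z => exp (-z) * (lagP n).eval z + (z+β)^2/z * exp (-z) * ell β z * (derivative (lagP n)).eval z
      + vIn (lft lam (GG δ)) z, ?_, ?_⟩
  · intro z hz
    have h1 : ContinuousOn (fun δ => ell β z * (lagP n).eval z + (z/(z+β))^2 * (exp (lam * z) * g δ ⟨z, hz⟩)) (Icc 0 (2/L)) := by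
      have : ContinuousOn (fun δ => g δ ⟨z, hz⟩) (Icc 0 (2/L)) :=
        (continuous_eval_const (F := EE) (⟨z, hz⟩ : Ioi (0:ℝ))).comp_continuousOn hgc
      fun_prop
    refine h1.congr fun δ hδ => ?_
    simp only
    rw [hout δ hδ z hz, lft_pos _ _ hz]
  · intro δ hδ
    have hGB := lft_GB lam (GG δ)
    have hexp : ∀ z : ℝ, HasDerivAt (fun t : ℝ => exp (-t)) (-exp (-z)) z := fun z =>
      ((hasDerivAt_neg z).exp).congr_deriv (by ring)
    have ode : ∀ z : ℝ, z * (derivative (derivative (lagP n))).eval z + (1 - z) * (derivative (lagP n)).eval z + n * (lagP n).eval z = 0 := by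
      intro z
      have := congrArg (eval z) (lagP_facts n).1
      simpa only [eval_add, eval_mul, eval_X, eval_sub, eval_one, eval_C, eval_zero] using this
    refine ⟨?_, ?_, ?_, ?_⟩
    · intro z hz
      have h1 := ((ell_deriv hβ hz).mul ((lagP n).hasDerivAt z)).add (hGB.out_deriv hβ hl hz)
      refine h1.congr_deriv ?_
      have e1 : exp (-z) = (exp z)⁻¹ := exp_neg z
      have : exp z ≠ 0 := (exp_pos z).ne'
      have : z + β ≠ 0 := by positivity
      beta_reduce
      rw [e1]
      field_simp
    · intro z hz
      have hm : HasDerivAt (fun z : ℝ => (z+β)^2/z) ((2 * (z+β) * z - (z+β)^2 * 1)/z^2) z := by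
        refine HasDerivAt.div ?_ (hasDerivAt_id z) hz.ne'
        exact (((hasDerivAt_id z).add_const β).pow 2).congr_deriv (by simp)
      have h1 := (((hexp z).mul ((lagP n).hasDerivAt z)).add (((hm.mul (hexp z)).mul (ell_deriv hβ hz)).mul ((derivative (lagP n)).hasDerivAt z))).add (hGB.in_deriv hl hz)
      refine h1.congr_deriv ?_
      beta_reduce
      simp only [Pi.mul_apply]
      rw [hGv δ z hz, hout δ hδ z hz]
      have o := ode z
      have o' : (derivative (derivative (lagP n))).eval z = (-(1 - z) * (derivative (lagP n)).eval z - n * (lagP n).eval z)/z := by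
        field_simp; linarith
      rw [o']
      have : z + β ≠ 0 := by positivity
      field_simp
      ring
    · have t1 : Tendsto (fun z => exp (-z) * (lagP n).eval z) (𝓝[>] 0) (𝓝 1) := by
        have : Continuous (fun z => exp (-z) * (lagP n).eval z) := by fun_prop
        have := (this.tendsto 0).mono_left (nhdsWithin_le_nhds (s := Ioi 0))
        simpa [lagP_zero_eval] using this
      have t2 : Tendsto (fun z => (z+β)^2/z * exp (-z) * ell β z * (derivative (lagP n)).eval z) (𝓝[>] 0) (𝓝 0) := by
        have c : Continuous (fun z => z * (1 + z/β) * A * exp z) := by fun_prop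
        have := (c.tendsto 0).mono_left (nhdsWithin_le_nhds (s := Ioi 0))
        simp only [zero_mul] at this
        refine squeeze_zero_norm' ?_ this
        filter_upwards [self_mem_nhdsWithin] with z hz
        have hz : 0 < z := hz
        have h1 := hP1 z hz.le
        have h2 := ell_upper hβ hz
        have h3 : log (1 + z/β) ≤ z/β := by
          have := log_le_sub_one_of_pos (by positivity : 0 < 1 + z/β); linarith
        have e : (z+β)^2/z * exp (-z) * ell β z = z * exp (-z) * (((z/(z+β))^2)⁻¹ * ell β z) := by
          field_simp
        rw [norm_eq_abs, abs_mul, e, abs_of_nonneg (mul_nonneg (by positivity) (hqe z hz))]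
        have h4 : exp (-z) ≤ 1 := by rw [exp_le_one_iff]; linarith
        have h5 := hqe z hz
        calc _ ≤ z * 1 * (1 + z/β) * (A * exp z) := by gcongr; linarith
          _ = _ := by ring
      have t3 : Tendsto (vIn (lft lam (GG δ))) (𝓝[>] 0) (𝓝 0) := by
        have c : Continuous (fun z => ‖GG δ‖ * z * exp ((lam - 1) * z)) := by fun_prop
        have := (c.tendsto 0).mono_left (nhdsWithin_le_nhds (s := Ioi 0))
        simp only [mul_zero, zero_mul] at this
        refine squeeze_zero_norm' ?_ this
        filter_upwards [self_mem_nhdsWithin] with z hz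
        exact hGB.in_bound hl hz
      simpa using (t1.add t2).add t3
    · intro z hz
      simp only [add_sub_cancel_left]
      rw [hout δ hδ z hz]
      have h1 := (lft_GB lam (g δ)).b z hz
      have h2 : ‖g δ‖ ≤ 9 * A := by
        refine (hg δ hδ).2.trans ?_
        have a : ‖f0‖ ≤ 5 * A := mkB_norm _ _ _ _
        have b : ‖f1‖ ≤ (1 + L) * A := mkB_norm _ _ _ _
        have c : ‖f0 + δ • f1‖ ≤ 9 * A := by
          refine (norm_add_le _ _).trans ?_
          rw [norm_smul, norm_eq_abs, abs_of_nonneg hδ.1]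
          have h3 : δ * L ≤ 2 := by have := hδ.2; rwa [le_div_iff₀ (by linarith)] at this
          have h4 : δ ≤ 2 := hδ.2.trans hK2
          have := mul_le_mul_of_nonneg_left b hδ.1
          nlinarith
        have d : ‖TT β lam hβ hl‖ ≤ 1/4 := hTn.trans (by gcongr)
        have := norm_nonneg (f0 + δ • f1)
        have := norm_nonneg (TT β lam hβ hl)
        nlinarith
      rw [abs_mul, abs_of_nonneg (by positivity : 0 ≤ (z/(z+β))^2)]
      calc _ ≤ (z/(z+β))^2 * (9 * A * exp (lam * z)) := by
            gcongr; exact h1.trans (by gcongr)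
        _ = _ := by ring

lemma cmp_deriv {f g f' g' : ℝ → ℝ} {a b : ℝ} (hab : a ≤ b)
    (hf : ∀ t ∈ Icc a b, HasDerivAt f (f' t) t) (hg : ∀ t ∈ Icc a b, HasDerivAt g (g' t) t)
    (h : ∀ t ∈ Icc a b, f' t ≤ g' t) : f b - f a ≤ g b - g a := by
  have hd : ∀ t ∈ Icc a b, HasDerivAt (fun t => g t - f t) (g' t - f' t) t :=
    fun t ht => (hg t ht).sub (hf t ht)
  have hm : MonotoneOn (fun t => g t - f t) (Icc a b) := by
    refine monotoneOn_of_deriv_nonneg (convex_Icc a b) (fun t ht => (hd t ht).continuousAt.continuousWithinAt) ?_ ?_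
    · intro t ht
      exact (hd t (interior_subset ht)).differentiableAt.differentiableWithinAt
    · intro t ht
      rw [(hd t (interior_subset ht)).deriv]
      linarith [h t (interior_subset ht)]
  have := hm (left_mem_Icc.2 hab) (right_mem_Icc.2 hab) hab
  simp only at this
  linarith

lemma cmp_abs {f g f' g' : ℝ → ℝ} {a b : ℝ} (hab : a ≤ b)
    (hf : ∀ t ∈ Icc a b, HasDerivAt f (f' t) t) (hg : ∀ t ∈ Icc a b, HasDerivAt g (g' t) t)
    (h : ∀ t ∈ Icc a b, |f' t| ≤ g' t) : |f b - f a| ≤ g b - g a := by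
  rw [abs_le]
  constructor
  · have := cmp_deriv hab (f := fun t => - f t) (f' := fun t => - f' t) (fun t ht => (hf t ht).neg) hg
      (fun t ht => by have := neg_abs_le (f' t); linarith [h t ht])
    linarith
  · exact cmp_deriv hab hf hg (fun t ht => (le_abs_self _).trans (h t ht))

lemma mono_deriv {f f' : ℝ → ℝ} {a b : ℝ} (hab : a ≤ b)
    (hf : ∀ t ∈ Icc a b, HasDerivAt f (f' t) t) (h : ∀ t ∈ Icc a b, 0 ≤ f' t) : f a ≤ f b := by
  have := cmp_deriv hab (f := fun _ => (0:ℝ)) (f' := fun _ => 0) (fun t _ => hasDerivAt_const t 0) hf h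
  linarith

lemma anti_deriv {f f' : ℝ → ℝ} {a b : ℝ} (hab : a ≤ b)
    (hf : ∀ t ∈ Icc a b, HasDerivAt f (f' t) t) (h : ∀ t ∈ Icc a b, f' t ≤ 0) : f b ≤ f a := by
  have := cmp_deriv hab (g := fun _ => (0:ℝ)) (g' := fun _ => 0) hf (fun t _ => hasDerivAt_const t 0) h
  linarith

lemma exp_lin_deriv (c z : ℝ) : HasDerivAt (fun t : ℝ => exp (c * t)) (c * exp (c * z)) z :=
  (((hasDerivAt_id z).const_mul c).exp).congr_deriv (by simp; ring)

lemma decay {f f' : ℝ → ℝ} {a C η : ℝ} (hη : 0 < η)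
    (hf : ∀ t, a ≤ t → HasDerivAt f (f' t) t) (h : ∀ t, a ≤ t → |f' t| ≤ C * exp (-η * t))
    (hC : 0 ≤ C)
    (hs : ∀ ε, 0 < ε → ∀ N, ∃ t, N ≤ t ∧ |f t| ≤ ε) : ∀ t, a ≤ t → |f t| ≤ C/η * exp (-η * t) := by
  intro z hz
  refine le_of_forall_pos_le_add fun ε hε => ?_
  obtain ⟨t, ht, hft⟩ := hs ε hε z
  have hg : ∀ s, HasDerivAt (fun s => -(C/η) * exp (-η * s)) (C * exp (-η * s)) s := fun s =>
    ((exp_lin_deriv (-η) s).const_mul (-(C/η))).congr_deriv (by field_simp)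
  have := cmp_abs ht (fun s hs => hf s (hz.trans hs.1)) (fun s _ => hg s) (fun s hs => h s (hz.trans hs.1))
  have h1 : |f z| ≤ |f t - f z| + |f t| := by
    have := abs_sub (f t) (f t - f z)
    rw [sub_sub_cancel] at this; linarith
  have h2 : 0 ≤ C/η * exp (-η * t) := by positivity
  linarith

lemma first_zero {f : ℝ → ℝ} {a z : ℝ} (haz : a ≤ z) (hc : ∀ t, a ≤ t → ContinuousAt f t) (hz : f z ≤ 0) :
    ∃ Z, a ≤ Z ∧ f Z ≤ 0 ∧ ∀ t, a ≤ t → t < Z → 0 < f t := by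
  set S := {t | t ∈ Icc a z ∧ f t ≤ 0} with hS
  have hcl : IsClosed S := by
    have : ContinuousOn f (Icc a z) := fun t ht => (hc t ht.1).continuousWithinAt
    have := this.preimage_isClosed_of_isClosed isClosed_Icc (isClosed_Iic (a := (0:ℝ)))
    exact this
  have hne : S.Nonempty := ⟨z, ⟨haz, le_rfl⟩, hz⟩
  have hbd : BddBelow S := ⟨a, fun t ht => ht.1.1⟩
  have hm := hcl.csInf_mem hne hbd
  refine ⟨sInf S, hm.1.1, hm.2, fun t h1 h2 => ?_⟩
  by_contra h
  push Not at h
  exact absurd (csInf_le hbd (⟨⟨h1, h2.le.trans hm.1.2⟩, h⟩ : t ∈ S)) (not_le.2 h2)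

noncomputable def rho (β z : ℝ) : ℝ := (z+β)^2/z * exp (-z)

lemma rho_pos {β z : ℝ} (hβ : 0 < β) (hz : 0 < z) : 0 < rho β z := by unfold rho; positivity

lemma rho_deriv {β z : ℝ} (hβ : 0 < β) (hz : 0 < z) :
    HasDerivAt (rho β) (rho β z * ((1 - 2*β/(z+β))/z - 1)) z := by
  have hexp : HasDerivAt (fun t : ℝ => exp (-t)) (-exp (-z)) z := 
      ((hasDerivAt_neg z).exp).congr_deriv (by ring)
  have hm : HasDerivAt (fun z : ℝ => (z+β)^2/z) ((2 * (z+β) * z - (z+β)^2 * 1)/z^2) z := by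
    refine HasDerivAt.div ?_ (hasDerivAt_id z) hz.ne'
    exact (((hasDerivAt_id z).add_const β).pow 2).congr_deriv (by simp)
  refine (hm.mul hexp).congr_deriv ?_
  have : z + β ≠ 0 := by positivity
  unfold rho
  field_simp
  ring

lemma rho_inv {β z : ℝ} (hβ : 0 < β) (hz : 0 < z) : exp z * (z/(z+β)^2) = (rho β z)⁻¹ := by
  unfold rho
  rw [exp_neg]
  have : z + β ≠ 0 := by positivity
  field_simp

lemma rho_c {β z : ℝ} (hβ : 0 < β) (hz : 0 < z) : ((z/(z+β))^2)⁻¹ * exp (-z) = rho β z / z := by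
  unfold rho
  have : z + β ≠ 0 := by positivity
  field_simp

structure Tail (n : ℕ) (A R0 β δ : ℝ) (p p1 w y : ℝ → ℝ) : Prop where
  hβ : 0 < β
  hL : 1 ≤ -log β
  hδ0 : 0 ≤ δ
  hδ : δ ≤ 2/(-log β)
  hR1 : 1 ≤ R0
  hR : 16*((n:ℝ)+3)/3 ≤ R0
  hA : 0 < A
  hw : ∀ z, R0 ≤ z → HasDerivAt w ((rho β z)⁻¹ * y z) z
  hy : ∀ z, R0 ≤ z → HasDerivAt y (-((n+δ) * (rho β z / z * w z))) z
  hJ : ∀ z, R0 ≤ z → HasDerivAt (fun z => y z * p z - rho β z * w z * p1 z)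
    (-(rho β z / z * w z * (δ * p z - 2*β/(z+β) * p1 z))) z
  hp : ∀ z, R0 ≤ z → HasDerivAt p (p1 z) z
  hp0 : ∀ z, R0 ≤ z → 1 ≤ p z
  hp1 : ∀ z, R0 ≤ z → 0 ≤ p1 z
  hp2 : ∀ z, R0 ≤ z → p1 z ≤ p z
  hpA : ∀ z, R0 ≤ z → p z ≤ A * exp (1/16 * z)

noncomputable def Th (β : ℝ) (w y : ℝ → ℝ) (z : ℝ) : ℝ := (y z - 1/4 * rho β z * w z) * w z
noncomputable def uu (w : ℝ → ℝ) (z : ℝ) : ℝ := w z ^ 2 * exp (-(1/2) * z)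

namespace Tail
variable {n : ℕ} {A R0 β δ : ℝ} {p p1 w y : ℝ → ℝ}

lemma β1 (T : Tail n A R0 β δ p p1 w y) : β ≤ 1 := by
  by_contra h; push Not at h
  have := log_pos h; linarith [T.hL]

lemma δ2 (T : Tail n A R0 β δ p p1 w y) : δ ≤ 2 := by
  refine T.hδ.trans ?_
  have := T.hL
  rw [div_le_iff₀ (by linarith)]; linarith

lemma βL (T : Tail n A R0 β δ p p1 w y) : β ≤ 1/(-log β) := by
  have h := log_le_sub_one_of_pos (inv_pos.2 T.hβ)
  have hβ := T.hβ
  rw [log_inv] at h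
  rw [le_div_iff₀ (by linarith [T.hL])]
  have : β * (β⁻¹ - 1) = 1 - β := by field_simp
  nlinarith

lemma kap (T : Tail n A R0 β δ p p1 w y) {z : ℝ} (hz : R0 ≤ z) : 0 ≤ 2*β/(z+β) ∧ 2*β/(z+β) ≤ 2 * β := by
  have hβ := T.hβ
  have := T.hR1
  have : 0 < z := by linarith
  constructor
  · positivity
  · exact div_le_self (by positivity) (by linarith)

lemma kapL (T : Tail n A R0 β δ p p1 w y) {z : ℝ} (hz : R0 ≤ z) : 2*β/(z+β) ≤ 2/(-log β) := by
  have h1 := (T.kap hz).2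
  have h2 := T.βL
  have : 2/(-log β) = 2 * (1/(-log β)) := by ring
  linarith

lemma rho_le (T : Tail n A R0 β δ p p1 w y) {z : ℝ} (hz : R0 ≤ z) : rho β z ≤ 4 * z * exp (-z) := by
  have h0 : 1 ≤ z := T.hR1.trans hz
  have h1 := T.β1
  have := T.hβ
  unfold rho
  gcongr
  rw [div_le_iff₀ (by linarith)]
  nlinarith

lemma Th_deriv (T : Tail n A R0 β δ p p1 w y) {z : ℝ} (hz : R0 ≤ z) :
    HasDerivAt (Th β w y) ((y z - 1/4 * rho β z * w z)^2/rho β z + rho β z / z * w z ^2 *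
      (3/16 * z - 1/4 * (1 - 2*β/(z+β)) - (n+δ))) z := by
  have h0 : 0 < z := by linarith [T.hR1]
  have hr := rho_pos T.hβ h0
  have := ((T.hy z hz).sub (((rho_deriv T.hβ h0).const_mul (1/4)).mul (T.hw z hz))).mul (T.hw z hz)
  refine this.congr_deriv ?_
  simp only [Pi.mul_apply, Pi.sub_apply]
  generalize 2*β/(z+β) = k
  field_simp
  ring

lemma Th_deriv_ge (T : Tail n A R0 β δ p p1 w y) {z : ℝ} (hz : R0 ≤ z) :
    (y z - 1/4 * rho β z * w z)^2/rho β z ≤ (y z - 1/4 * rho β z * w z)^2/rho β z + rho β z / z * w z ^2 *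
      (3/16 * z - 1/4 * (1 - 2*β/(z+β)) - (n+δ)) := by
  have h0 : 0 < z := by linarith [T.hR1]
  have hr := rho_pos T.hβ h0
  have : 0 ≤ 3/16 * z - 1/4 * (1 - 2*β/(z+β)) - (n+δ) := by
    have h1 := T.hR
    have h2 := (T.kap hz).1
    have h3 := T.δ2
    linarith
  have : 0 ≤ rho β z / z * w z ^2 * (3/16 * z - 1/4 * (1 - 2*β/(z+β)) - (n+δ)) := by positivity
  linarith

lemma Th_mono (T : Tail n A R0 β δ p p1 w y) {a b : ℝ} (ha : R0 ≤ a) (hab : a ≤ b) : Th β w y a ≤ Th β w y b := by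
  refine mono_deriv hab (fun t ht => T.Th_deriv (ha.trans ht.1)) fun t ht => le_trans ?_ (T.Th_deriv_ge (ha.trans ht.1))
  have := rho_pos T.hβ (by linarith [T.hR1, ht.1] : 0 < t)
  positivity

lemma uu_deriv (T : Tail n A R0 β δ p p1 w y) {z : ℝ} (hz : R0 ≤ z) :
    HasDerivAt (uu w) (2 * Th β w y z * exp (-(1/2) * z) / rho β z) z := by
  have h0 : 0 < z := by linarith [T.hR1]
  have hr := rho_pos T.hβ h0
  have := ((T.hw z hz).pow 2).mul (exp_lin_deriv (-(1/2)) z)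
  refine this.congr_deriv ?_
  unfold Th
  simp only [Pi.pow_apply]
  field_simp
  norm_num
  ring

/-- positivity of Θ gives strict growth -/
lemma uu_strict (T : Tail n A R0 β δ p p1 w y) {a b : ℝ} (ha : R0 ≤ a) (hab : a < b) (h : 0 < Th β w y a) :
    uu w a < uu w b := by
  have hm : StrictMonoOn (uu w) (Icc a b) := by
    refine strictMonoOn_of_deriv_pos (convex_Icc a b) (fun t ht => (T.uu_deriv (ha.trans ht.1)).continuousAt.continuousWithinAt) ?_
    intro t ht
    have ht := interior_subset ht
    rw [(T.uu_deriv (ha.trans ht.1)).deriv]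
    have := rho_pos T.hβ (by linarith [T.hR1, ht.1] : 0 < t)
    have := h.trans_le (T.Th_mono ha ht.1)
    positivity
  exact hm (left_mem_Icc.2 hab.le) (right_mem_Icc.2 hab.le) hab

lemma Th_pos_of (T : Tail n A R0 β δ p p1 w y) {a b : ℝ} (ha : R0 ≤ a) (hab : a < b) (h : uu w a < uu w b) :
    0 < Th β w y b := by
  by_contra hn
  push Not at hn
  have := anti_deriv hab.le (fun t ht => T.uu_deriv (ha.trans ht.1)) (fun t ht => by
    have h1 := rho_pos T.hβ (by linarith [T.hR1, ht.1] : 0 < t)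
    have h2 := (T.Th_mono (ha.trans ht.1) ht.2).trans hn
    have : 2 * Th β w y t * exp (-(1/2) * t) ≤ 0 := by
      have := exp_pos (-(1/2) * t); nlinarith
    exact div_nonpos_of_nonpos_of_nonneg this h1.le)
  linarith

lemma w_cont (T : Tail n A R0 β δ p p1 w y) {z : ℝ} (hz : R0 ≤ z) : ContinuousAt w z := (T.hw z hz).continuousAt

lemma w_ne (T : Tail n A R0 β δ p p1 w y) {a b : ℝ} (ha : R0 ≤ a) (hab : a ≤ b) (h : 0 < Th β w y a) : w b ≠ 0 := by
  intro h0
  have := h.trans_le (T.Th_mono ha hab)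
  simp [Th, h0] at this

end Tail

def Up (R0 : ℝ) (w : ℝ → ℝ) : Prop := ∃ a b, R0 ≤ a ∧ a < b ∧ uu w a < uu w b ∧ 0 < w b
def Dn (R0 : ℝ) (w : ℝ → ℝ) : Prop := ∃ a b, R0 ≤ a ∧ a < b ∧ uu w a < uu w b ∧ w b < 0

namespace Tail
variable {n : ℕ} {A R0 β δ : ℝ} {p p1 w y : ℝ → ℝ}

lemma disj (T : Tail n A R0 β δ p p1 w y) (h1 : Up R0 w) (h2 : Dn R0 w) : False := by
  obtain ⟨a, b, ha, hab, hu, hw⟩ := h1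
  obtain ⟨a', b', ha', hab', hu', hw'⟩ := h2
  have hT := T.Th_pos_of ha hab hu
  have hT' := T.Th_pos_of ha' hab' hu'
  rcases le_total b b' with h | h
  · have hc : ContinuousOn w (Icc b b') := fun t ht => (T.w_cont (by linarith [ht.1])).continuousWithinAt
    obtain ⟨t, ht, h0⟩ := intermediate_value_Icc' h hc (⟨hw'.le, hw.le⟩ : (0:ℝ) ∈ Icc (w b') (w b))
    exact T.w_ne (by linarith) ht.1 hT h0
  · have hc : ContinuousOn w (Icc b' b) := fun t ht => (T.w_cont (by linarith [ht.1])).continuousWithinAt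
    obtain ⟨t, ht, h0⟩ := intermediate_value_Icc h hc (⟨hw'.le, hw.le⟩ : (0:ℝ) ∈ Icc (w b') (w b))
    exact T.w_ne (by linarith) ht.1 hT' h0

lemma trich (T : Tail n A R0 β δ p p1 w y) (h1 : ¬ Up R0 w) (h2 : ¬ Dn R0 w) : ∀ z, R0 ≤ z → Th β w y z ≤ 0 := by
  intro z hz
  by_contra h
  push Not at h
  have hs := T.uu_strict hz (lt_add_one z) h
  rcases lt_or_gt_of_ne (T.w_ne hz (lt_add_one z).le h) with h3 | h3
  · exact h2 ⟨z, z+1, hz, lt_add_one z, hs, h3⟩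
  · exact h1 ⟨z, z+1, hz, lt_add_one z, hs, h3⟩

lemma quot_deriv (T : Tail n A R0 β δ p p1 w y) {z : ℝ} (hz : R0 ≤ z) :
    HasDerivAt (fun z => w z / p z) ((y z * p z - rho β z * w z * p1 z)/(rho β z * p z ^2)) z := by
  have h0 : 0 < z := by linarith [T.hR1]
  have hr := rho_pos T.hβ h0
  have hp := T.hp0 z hz
  have hp' : p z ≠ 0 := by positivity
  refine ((T.hw z hz).div (T.hp z hz) hp').congr_deriv ?_
  field_simp

lemma w_bound (T : Tail n A R0 β δ p p1 w y) (h : ∀ z, R0 ≤ z → Th β w y z ≤ 0) {z : ℝ} (hz : R0 ≤ z) :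
    |w z| ≤ |w R0| * exp (1/4 * z) := by
  have h1 := anti_deriv hz (fun t ht => T.uu_deriv ht.1) (fun t ht => by
    have h1 := rho_pos T.hβ (by linarith [T.hR1, ht.1] : 0 < t)
    have h2 := h t ht.1
    have : 2 * Th β w y t * exp (-(1/2) * t) ≤ 0 := by
      have := exp_pos (-(1/2) * t); nlinarith
    exact div_nonpos_of_nonpos_of_nonneg this h1.le)
  refine abs_le_of_sq_le_sq ?_ (by positivity)
  rw [mul_pow, sq_abs, ← exp_nat_mul]
  unfold uu at h1
  have h2 : exp (-(1/2) * R0) ≤ 1 := by rw [exp_le_one_iff]; linarith [T.hR1]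
  have h3 : w z ^ 2 * exp (-(1/2) * z) ≤ w R0 ^ 2 := h1.trans (mul_le_of_le_one_right (sq_nonneg _) h2)
  have h4 : exp ((2:ℕ) * (1/4 * z)) = (exp (-(1/2) * z))⁻¹ := by rw [← exp_neg]; congr 1; push_cast; ring
  rw [h4, ← div_eq_mul_inv, le_div_iff₀ (exp_pos _)]
  exact h3

end Tail

lemma exp_small (K η ε : ℝ) (hη : 0 < η) (hε : 0 < ε) : ∃ N, ∀ t, N ≤ t → K * exp (-η * t) ≤ ε := by
  have : Tendsto (fun t => K * exp (-η * t)) atTop (𝓝 (K * 0)) := by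
    refine Tendsto.const_mul K (tendsto_exp_atBot.comp ?_)
    exact tendsto_id.const_mul_atTop_of_neg (by linarith)
  rw [mul_zero] at this
  obtain ⟨N, hN⟩ := eventually_atTop.1 (this.eventually (eventually_le_nhds hε))
  exact ⟨N, hN⟩

lemma expadd {a b c : ℝ} (h : a + b = c) : exp a * exp b = exp c := by rw [← exp_add, h]

namespace Tail
variable {n : ℕ} {A R0 β δ : ℝ} {p p1 w y : ℝ → ℝ}

lemma rho_le' (T : Tail n A R0 β δ p p1 w y) {z : ℝ} (hz : R0 ≤ z) : rho β z ≤ 32 * exp (-(7/8) * z) := by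
  refine (T.rho_le hz).trans ?_
  have h := add_one_le_exp (1/8 * z)
  have h2 : exp (1/8 * z) * exp (-z) = exp (-(7/8) * z) := expadd (by ring)
  rw [← h2]
  have := exp_pos (-z)
  nlinarith

lemma rho_z (T : Tail n A R0 β δ p p1 w y) {z : ℝ} (hz : R0 ≤ z) : rho β z / z ≤ 4 * exp (-z) := by
  have h0 : 0 < z := by linarith [T.hR1]
  rw [div_le_iff₀ h0]
  have := T.rho_le hz
  linarith

lemma pp (T : Tail n A R0 β δ p p1 w y) {z : ℝ} (hz : R0 ≤ z) : 0 < p z := by linarith [T.hp0 z hz]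

lemma up0 (T : Tail n A R0 β 0 p p1 w y) (hw0 : 0 < w R0)
    (hJ0 : 1/2 ≤ y R0 * p R0 - rho β R0 * w R0 * p1 R0) : Up R0 w := by
  have key : ∀ Z, R0 ≤ Z → (∀ t, R0 ≤ t → t < Z → 0 < w t) →
      (1/2 ≤ y Z * p Z - rho β Z * w Z * p1 Z ∧ 0 < w Z) := by
    intro Z hZ h
    have hwn : ∀ t, R0 ≤ t → t ≤ Z → 0 ≤ w t := by
      intro t h1 h2
      rcases eq_or_lt_of_le h1 with h4 | h4
      · rw [← h4]; exact hw0.le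
      rcases lt_or_eq_of_le h2 with h3 | h3
      · exact (h t h1 h3).le
      · subst h3
        have hc := (T.w_cont h1).tendsto.mono_left (nhdsWithin_le_nhds (s := Iio t))
        refine ge_of_tendsto hc ?_
        filter_upwards [Ioo_mem_nhdsLT h4] with s hs
        exact (h s hs.1.le hs.2).le
    have hJ : ∀ t, R0 ≤ t → t ≤ Z → 1/2 ≤ y t * p t - rho β t * w t * p1 t := by
      intro t h1 h2
      refine hJ0.trans (mono_deriv h1 (fun s hs => T.hJ s hs.1) fun s hs => ?_)
      have a1 := hwn s hs.1 (hs.2.trans h2)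
      have a2 := T.hp1 s hs.1
      have a3 := (T.kap hs.1).1
      have a0 : 0 < s := by linarith [T.hR1, hs.1]
      have a4 := rho_pos T.hβ a0
      have : 0 ≤ rho β s / s * w s * (2*β/(s+β) * p1 s) := by positivity
      linarith
    refine ⟨hJ Z hZ le_rfl, ?_⟩
    have := mono_deriv hZ (fun t ht => T.quot_deriv ht.1) (fun t ht => by
      have a0 : 0 < t := by linarith [T.hR1, ht.1]
      have a4 := rho_pos T.hβ a0
      have a5 := hJ t ht.1 ht.2
      have a6 := T.pp ht.1
      exact div_nonneg (by linarith) (by positivity))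
    have h1 : 0 < w R0 / p R0 := div_pos hw0 (T.pp le_rfl)
    have h2 := h1.trans_le this
    exact (div_pos_iff_of_pos_right (T.pp hZ)).1 h2
  have hpos : ∀ z, R0 ≤ z → 0 < w z := by
    intro z hz
    by_contra hn
    push Not at hn
    obtain ⟨Z, h1, h2, h3⟩ := first_zero hz (fun t ht => T.w_cont ht) hn
    exact absurd (key Z h1 h3).2 (not_lt.2 h2)
  by_contra hU
  have hTh := T.trich hU (by
    rintro ⟨a, b, ha, hab, -, hb⟩
    linarith [hpos b (by linarith)])
  obtain ⟨N, hN⟩ := exp_small (8 * |w R0| * A) (9/16) (1/4) (by norm_num) (by norm_num)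
  set z := max N R0
  have hz : R0 ≤ z := le_max_right _ _
  have h1 := hN z (le_max_left _ _)
  have h2 := (key z hz (fun t ht _ => hpos t ht)).1
  have h3 := hTh z hz
  have hwz := hpos z hz
  have h4 : y z ≤ 1/4 * rho β z * w z := by
    unfold Th at h3
    by_contra hc
    push Not at hc
    have := mul_pos (sub_pos.2 hc) hwz
    linarith
  have h5 := T.w_bound hTh hz
  rw [abs_of_pos hwz] at h5
  have h6 := T.rho_le' hz
  have h7 := T.hpA z hz
  have hr := rho_pos T.hβ (by linarith [T.hR1] : 0 < z)
  have hp := T.pp hz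
  have h8 : y z * p z ≤ 8 * |w R0| * A * exp (-(9/16) * z) := by
    have e1 : exp (-(7/8) * z) * exp (1/4 * z) * exp (1/16 * z) = exp (-(9/16) * z) := by
      rw [expadd rfl, expadd rfl]; congr 1; ring
    calc y z * p z ≤ (1/4 * rho β z * w z) * p z := by gcongr
      _ ≤ (1/4 * (32 * exp (-(7/8) * z)) * (|w R0| * exp (1/4 * z))) * (A * exp (1/16 * z)) := by gcongr
      _ = 8 * |w R0| * A * (exp (-(7/8) * z) * exp (1/4 * z) * exp (1/16 * z)) := by ring
      _ = _ := by rw [e1]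
  have h9 : 0 ≤ rho β z * w z * p1 z := by have := T.hp1 z hz; positivity
  linarith

lemma dn0 (T : Tail n A R0 β (2/(-log β)) p p1 w y) (hw0 : 0 < w R0)
    (hJ0 : y R0 * p R0 - rho β R0 * w R0 * p1 R0 ≤ -1/4) : Dn R0 w := by
  have hneg : ∃ z, R0 ≤ z ∧ w z < 0 := by
    by_contra hn
    push Not at hn
    have hJ : ∀ t, R0 ≤ t → y t * p t - rho β t * w t * p1 t ≤ -1/4 := by
      intro t h1
      refine (anti_deriv h1 (fun s hs => T.hJ s hs.1) fun s hs => ?_).trans hJ0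
      have a1 := hn s hs.1
      have a2 := T.hp1 s hs.1
      have a2' := T.hp2 s hs.1
      have a3 := T.kapL hs.1
      have a3' := (T.kap hs.1).1
      have a0 : 0 < s := by linarith [T.hR1, hs.1]
      have a4 := rho_pos T.hβ a0
      have a5 : 2*β/(s+β) * p1 s ≤ 2/(-log β) * p s := by gcongr; exact a3'.trans a3
      have : 0 ≤ rho β s / s * w s * (2/(-log β) * p s - 2*β/(s+β) * p1 s) := by
        have := sub_nonneg.2 a5; positivity
      linarith
    have hA := T.hA
    set c := 1/(4 * (32 * A^2)) with hc
    have hcp : 0 < c := by positivity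
    set z := R0 + w R0 / p R0 / c + 1 with hzdef
    have hq : 0 < w R0 / p R0 := div_pos hw0 (T.pp le_rfl)
    have hz : R0 ≤ z := by have : 0 < w R0 / p R0 / c := div_pos hq hcp; linarith
    have := cmp_deriv hz (fun t ht => T.quot_deriv ht.1) (g := fun t => -c * t) (g' := fun _ => -c)
      (fun t _ => ((hasDerivAt_id t).const_mul (-c)).congr_deriv (by simp)) (fun t ht => by
      have a0 : 0 < t := by linarith [T.hR1, ht.1]
      have a4 := rho_pos T.hβ a0
      have a5 := hJ t ht.1
      have a6 := T.pp ht.1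
      have a7 : rho β t * p t ^ 2 ≤ 32 * A^2 := by
        have b1 := T.rho_le' ht.1
        have b2 := T.hpA t ht.1
        calc rho β t * p t ^ 2 ≤ (32 * exp (-(7/8) * t)) * (A * exp (1/16 * t))^2 := by gcongr
          _ = 32 * A^2 * exp (-(3/4) * t) := by
            rw [mul_pow, ← exp_nat_mul]
            have : exp (-(7/8) * t) * exp ((2:ℕ) * (1/16*t)) = exp (-(3/4) * t) := expadd (by push_cast; ring)
            rw [← this]; ring
          _ ≤ 32 * A^2 * 1 := by
            gcongr; rw [exp_le_one_iff]; linarith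
          _ = _ := mul_one _
      have a8 : 0 < rho β t * p t ^2 := by positivity
      rw [div_le_iff₀ a8]
      have : c * (rho β t * p t ^ 2) ≤ 1/4 := by
        calc c * (rho β t * p t ^ 2) ≤ c * (32 * A^2) := by gcongr
          _ = 1/4 := by rw [hc]; field_simp
      linarith)
    have h1 : 0 ≤ w z / p z := div_nonneg (hn z hz) (T.pp hz).le
    have h2 : -c * z - -c * R0 = -(w R0 / p R0) - c := by rw [hzdef]; field_simp; ring
    linarith
  obtain ⟨b, hb, hwb⟩ := hneg
  have hc : ContinuousOn w (Icc R0 b) := fun t ht => (T.w_cont ht.1).continuousWithinAt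
  obtain ⟨t, ht, h0⟩ := intermediate_value_Icc' hb hc (⟨hwb.le, hw0.le⟩ : (0:ℝ) ∈ Icc (w b) (w R0))
  refine ⟨t, b, ht.1, lt_of_le_of_ne ht.2 ?_, ?_, hwb⟩
  · rintro rfl; linarith
  · have : w b ≠ 0 := hwb.ne
    simp only [uu, h0]
    have := exp_pos (-(1/2)*b)
    rw [zero_pow two_ne_zero, zero_mul]
    positivity

lemma y_small (T : Tail n A R0 β δ p p1 w y) (h : ∀ z, R0 ≤ z → Th β w y z ≤ 0) (ε : ℝ) (hε : 0 < ε) (N : ℝ) :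
    ∃ t, N ≤ t ∧ |y t| ≤ ε := by
  obtain ⟨N1, hN1⟩ := exp_small (6 + 8 * |w R0|) (7/16) ε (by norm_num) hε
  set M := max R0 (max N N1) with hM
  have hMR : R0 ≤ M := le_max_left _ _
  by_contra hn
  push Not at hn
  have hbig : ∀ t, M ≤ t → rho β t ≤ (y t - 1/4 * rho β t * w t)^2 := by
    intro t ht
    by_contra hc
    push Not at hc
    have htR : R0 ≤ t := hMR.trans ht
    have h1 := hn t ((le_max_left _ _).trans ((le_max_right _ _).trans ht))
    have h2 := hN1 t ((le_max_right _ _).trans ((le_max_right _ _).trans ht))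
    have h3 := T.rho_le' htR
    have hr := rho_pos T.hβ (by linarith [T.hR1] : 0 < t)
    have h4 : |y t - 1/4 * rho β t * w t| ≤ 6 * exp (-(7/16) * t) := by
      refine abs_le_of_sq_le_sq ?_ (by positivity)
      rw [mul_pow, ← exp_nat_mul]
      have e : ((2:ℕ):ℝ) * (-(7/16) * t) = -(7/8) * t := by push_cast; ring
      rw [e]
      have := exp_pos (-(7/8) * t)
      linarith
    have h5 : |1/4 * rho β t * w t| ≤ 8 * |w R0| * exp (-(7/16) * t) := by
      rw [abs_mul, abs_of_pos (by positivity : 0 < 1/4 * rho β t)]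
      calc _ ≤ (1/4 * (32 * exp (-(7/8) * t))) * (|w R0| * exp (1/4 * t)) := by
            gcongr; exact T.w_bound h htR
        _ = 8 * |w R0| * (exp (-(7/8) * t) * exp (1/4 * t)) := by ring
        _ ≤ _ := by
          rw [expadd rfl]; gcongr; linarith [T.hR1]
    have h6 := abs_add_le (y t - 1/4 * rho β t * w t) (1/4 * rho β t * w t)
    rw [sub_add_cancel] at h6
    linarith
  set z := M + 1 - Th β w y M with hz
  have hMz : M ≤ z := by linarith [h M hMR]
  have := cmp_deriv hMz (f := fun t => t) (f' := fun _ => 1) (fun t _ => hasDerivAt_id t)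
    (fun t ht => T.Th_deriv (hMR.trans ht.1)) (fun t ht => by
      have htR := hMR.trans ht.1
      refine le_trans ?_ (T.Th_deriv_ge htR)
      rw [le_div_iff₀ (rho_pos T.hβ (by linarith [T.hR1] : 0 < t)), one_mul]
      exact hbig t ht.1)
  have h1 := h z (hMR.trans hMz)
  linarith

/-- The basic decay of `y`. -/
lemma y_decay (T : Tail n A R0 β δ p p1 w y) (h : ∀ z, R0 ≤ z → Th β w y z ≤ 0) :
    ∃ Y, 0 ≤ Y ∧ ∀ z, R0 ≤ z → |y z| ≤ Y * exp (-(3/4) * z) := by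
  have hd := T.δ2
  have hd0 := T.hδ0
  refine ⟨((n+2) * 4 * |w R0|)/(3/4), by positivity, decay (by norm_num) T.hy ?_ (by positivity) ?_⟩
  · intro t ht
    have h0 : 0 < t := by linarith [T.hR1]
    have hr := rho_pos T.hβ h0
    rw [abs_neg, abs_mul, abs_mul, abs_of_nonneg (by positivity : 0 ≤ (n:ℝ) + δ), abs_of_pos (by positivity : 0 < rho β t / t)]
    calc _ ≤ ((n:ℝ)+2) * (4 * exp (-t) * (|w R0| * exp (1/4 * t))) := by
            gcongr
            · exact T.rho_z ht
            · exact T.w_bound h ht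
      _ = (n+2) * 4 * |w R0| * (exp (-t) * exp (1/4 * t)) := by ring
      _ = _ := by rw [expadd (by ring : -t + 1/4 * t = -(3/4) * t)]
  · exact fun ε hε N => T.y_small h ε hε N

lemma J_crude (T : Tail n A R0 β δ p p1 w y) (h : ∀ z, R0 ≤ z → Th β w y z ≤ 0) :
    ∃ Y, ∀ z, R0 ≤ z → |y z * p z - rho β z * w z * p1 z| ≤ Y * exp (-(9/16) * z) := by
  obtain ⟨Y, hY, hy⟩ := T.y_decay h
  have hA := T.hA
  refine ⟨Y * A + 32 * |w R0| * A, fun z hz => ?_⟩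
  have h0 : 0 < z := by linarith [T.hR1]
  have hr := rho_pos T.hβ h0
  have hp := T.pp hz
  refine (abs_sub _ _).trans ?_
  rw [abs_mul, abs_mul, abs_mul, abs_of_pos hp, abs_of_pos hr, abs_of_nonneg (T.hp1 z hz), add_mul]
  refine add_le_add ?_ ?_
  · calc |y z| * p z ≤ (Y * exp (-(3/4) * z)) * (A * exp (1/16*z)) := by
          gcongr; exacts [hy z hz, T.hpA z hz]
      _ = Y * A * (exp (-(3/4) * z) * exp (1/16*z)) := by ring
      _ ≤ _ := by rw [expadd rfl]; gcongr; linarith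
  · calc rho β z * |w z| * p1 z ≤ (32 * exp (-(7/8) * z)) * (|w R0| * exp (1/4 * z)) * (A * exp (1/16*z)) := by
          have := T.hp1 z hz
          gcongr
          exacts [T.rho_le' hz, T.w_bound h hz, (T.hp2 z hz).trans (T.hpA z hz)]
      _ = 32 * |w R0| * A * (exp (-(7/8) * z) * exp (1/4 * z) * exp (1/16*z)) := by ring
      _ = _ := by rw [expadd rfl, expadd rfl]; congr 2; ring

lemma asym (T : Tail n A R0 β δ p p1 w y) (h : ∀ z, R0 ≤ z → Th β w y z ≤ 0) {K : ℝ} (hK : 0 ≤ K) {E : ℝ → ℝ}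
    (hβ2 : β * (-log β)^2 ≤ 4)
    (hwK : |w R0| ≤ K * (-log β)) (hqK : |w R0 / p R0 - (-log β)| ≤ K)
    (hE : ∀ z, R0 ≤ z → HasDerivAt E (exp (-z) * p z ^ 2) z) (hE1 : Tendsto E atTop (𝓝 1))
    (hG : |y R0 * p R0 - rho β R0 * w R0 * p1 R0 - 1 + δ * (-log β) * E R0| ≤ K / (-log β)) :
    |δ * (-log β) - 1| ≤ (K + 2 * (2 * A * (3 * K + A * (K + 77 * K * A)) + 32 * K * A)) / (-log β) := by
  have hL1 := T.hL
  have hβL := T.βL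
  have hkapL := fun z hz => T.kapL (z := z) hz
  have hδL := T.hδ
  have hβ1 := T.β1
  have hβ := T.hβ
  have hδ0 := T.hδ0
  set L := -log β with hL
  have hLp : 0 < L := by linarith
  have hA := T.hA
  have hw : ∀ z, R0 ≤ z → |w z| ≤ K * L * exp (1/4 * z) := fun z hz =>
    (T.w_bound h hz).trans (by gcongr)
  obtain ⟨Y, hY⟩ := T.J_crude h
  -- decay of J
  have hJ : ∀ z, R0 ≤ z → |y z * p z - rho β z * w z * p1 z| ≤ 24 * K * A * exp (-(11/16) * z) := by
    intro z hz
    have := decay (η := 11/16) (C := 16 * K * A) (by norm_num) T.hJ (fun t ht => by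
      have h0 : 0 < t := by linarith [T.hR1]
      have hr := rho_pos T.hβ h0
      rw [abs_neg, abs_mul, abs_mul, abs_of_pos (by positivity : 0 < rho β t / t)]
      have h1 : |δ * p t - 2*β/(t+β) * p1 t| ≤ 4/L * (A * exp (1/16 * t)) := by
        refine (abs_sub _ _).trans ?_
        have a1 := T.hp1 t ht
        have a2 := T.hp2 t ht
        have a3 := T.hpA t ht
        have a4 := T.pp ht
        have a5 := (T.kap ht).1
        rw [abs_mul, abs_mul, abs_of_nonneg hδ0, abs_of_pos a4, abs_of_nonneg a1, abs_of_nonneg a5]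
        have b1 : δ * p t ≤ 2/L * (A * exp (1/16 * t)) := by gcongr
        have b2 : 2*β/(t+β) * p1 t ≤ 2/L * (A * exp (1/16 * t)) := by
          exact mul_le_mul (hkapL t ht) (by linarith) a1 (by positivity)
        have : 4/L = 2/L + 2/L := by ring
        rw [this, add_mul]; linarith
      calc _ ≤ (4 * exp (-t)) * (K * L * exp (1/4 * t)) * (4/L * (A * exp (1/16 * t))) := by
            gcongr
            exacts [T.rho_z ht, hw t ht]
        _ = 16 * K * A * (exp (-t) * exp (1/4 * t) * exp (1/16 * t)) := by field_simp; ring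
        _ = _ := by rw [expadd rfl, expadd rfl]; congr 2; ring) (by positivity) (fun ε hε N => by
      obtain ⟨M, hM⟩ := exp_small Y (9/16) ε (by norm_num) hε
      exact ⟨max N (max M R0), le_max_left _ _, (hY _ ((le_max_right _ _).trans (le_max_right _ _))).trans
        (hM _ ((le_max_left _ _).trans (le_max_right _ _)))⟩) z hz
    refine this.trans ?_
    gcongr
    have : 0 ≤ K * A := by positivity
    linarith
  have hq : ∀ z, R0 ≤ z → |w z / p z - L| ≤ (K + 77 * K * A) * exp (5/16 * z) := by
    intro z hz
    have := cmp_abs hz (fun t ht => T.quot_deriv ht.1) (g := fun t => (24 * K * A * (16/5)) * exp (5/16 * t))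
      (fun t _ => (exp_lin_deriv (5/16) t).const_mul _) (fun t ht => by
      have h0 : 0 < t := by linarith [T.hR1, ht.1]
      have h1 : 1 ≤ t := by linarith [T.hR1, ht.1]
      have hr := rho_pos T.hβ h0
      have hp := T.hp0 t ht.1
      have hp' := T.pp ht.1
      rw [abs_div, abs_of_pos (by positivity : 0 < rho β t * p t ^ 2), div_le_iff₀ (by positivity)]
      have hr2 : exp (-t) ≤ rho β t := by
        unfold rho
        refine le_mul_of_one_le_left (exp_pos _).le ?_
        rw [le_div_iff₀ h0]
        nlinarith
      have hr3 : exp (-t) * 1 ≤ rho β t * p t ^ 2 := by gcongr; exact one_le_pow₀ hp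
      refine (hJ t ht.1).trans ?_
      calc 24 * K * A * exp (-(11/16) * t) = 24 * K * A * (16/5) * (5/16 * exp (5/16 * t)) * (exp (-t) * 1) := by
            rw [← expadd (by ring : 5/16 * t + -t = -(11/16) * t)]; ring
        _ ≤ _ := by gcongr)
    have h2 : |w z / p z - L| ≤ |w z / p z - w R0 / p R0| + |w R0 / p R0 - L| := abs_sub_le _ _ _
    have h3 : 1 ≤ exp (5/16 * z) := by rw [one_le_exp_iff]; linarith [T.hR1]
    have h4 : 0 ≤ 24 * K * A * (16/5) * exp (5/16 * R0) := by positivity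
    have h5 : K ≤ K * exp (5/16 * z) := le_mul_of_one_le_right hK h3
    have h6 : 0 ≤ K * A * exp (5/16 * z) := by positivity
    nlinarith
  set K2 := 3 * K + A * (K + 77 * K * A) with hK2
  have hK20 : 0 ≤ K2 := by positivity
  set K3 := 2 * A * K2 + 32 * K * A with hK3
  have hK30 : 0 ≤ K3 := by positivity
  have hGz : ∀ z, R0 ≤ z → |y z * p z - rho β z * w z * p1 z - 1 + δ * L * E z| ≤ (K + 2 * K3)/L := by
    intro z hz
    have := cmp_abs hz (f := fun z => y z * p z - rho β z * w z * p1 z - 1 + δ * L * E z)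
      (fun t ht => ((T.hJ t ht.1).sub_const 1).add ((hE t ht.1).const_mul (δ * L)))
      (g := fun t => -(K3/L * (16/9)) * exp (-(9/16) * t)) (fun t _ => (exp_lin_deriv (-(9/16)) t).const_mul _)
      (fun t ht => by
        have htR := ht.1
        have h0 : 0 < t := by linarith [T.hR1, ht.1]
        have h1 : 1 ≤ t := by linarith [T.hR1, ht.1]
        have hp' := T.pp ht.1
        have a1 := T.hp1 t htR
        have a3 := T.hpA t htR
        have a2 : p1 t ≤ A * exp (1/16 * t) := (T.hp2 t htR).trans a3
        set qi := ((t/(t+β))^2)⁻¹ with hqi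
        have hqi' : qi = (1 + β/t)^2 := by rw [hqi]; field_simp
        have hbt : β/t ≤ β := div_le_self hβ.le h1
        have hbt0 : 0 < β/t := by positivity
        have hq1 : 1 ≤ qi := by rw [hqi']; nlinarith
        have hq2 : qi ≤ 1 + 3 * β := by rw [hqi']; nlinarith
        rw [← rho_c hβ h0]
        have e1 : -(qi * exp (-t) * w t * (δ * p t - 2*β/(t+β) * p1 t)) + δ * L * (exp (-t) * p t ^2)
            = -(exp (-t) * (δ * p t * (qi * w t - L * p t) - 2*β/(t+β) * qi * w t * p1 t)) := by ring
        have b1 : |qi * w t - L * p t| ≤ K2 * exp (3/8 * t) := by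
          have e2 : qi * w t - L * p t = (qi - 1) * w t + p t * (w t / p t - L) := by field_simp; ring
          rw [e2, hK2, add_mul]
          refine (abs_add_le _ _).trans ?_
          rw [abs_mul, abs_mul, abs_of_nonneg (by linarith : 0 ≤ qi - 1), abs_of_pos hp']
          refine add_le_add ?_ ?_
          · calc (qi - 1) * |w t| ≤ (3 * (1/L)) * (K * L * exp (1/4 * t)) := by
                  gcongr
                  · linarith
                  · exact hw t htR
              _ = 3 * K * exp (1/4 * t) := by field_simp
              _ ≤ _ := by
                have : 1/4 * t ≤ 3/8 * t := by linarith
                gcongr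
          · calc p t * |w t / p t - L| ≤ (A * exp (1/16 * t)) * ((K + 77 * K * A) * exp (5/16 * t)) := by
                  gcongr; exact hq t htR
              _ = A * (K + 77 * K * A) * (exp (1/16 * t) * exp (5/16 * t)) := by ring
              _ = _ := by rw [expadd rfl]; congr 2; ring
        have b2 : |2*β/(t+β) * qi * w t * p1 t| ≤ 32 * K * A / L * exp (5/16 * t) := by
          rw [abs_mul, abs_mul, abs_of_nonneg (mul_nonneg (T.kap htR).1 (by linarith)), abs_of_nonneg a1]
          have hβ4 : β ≤ 4/L^2 := by rw [le_div_iff₀ (by positivity)]; exact hβ2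
          calc _ ≤ (2 * (4/L^2) * 4) * (K * L * exp (1/4 * t)) * (A * exp (1/16 * t)) := by
                gcongr
                · exact (T.kap htR).2.trans (by linarith)
                · linarith
                · exact hw t htR
            _ = 32 * K * A / L * (exp (1/4 * t) * exp (1/16 * t)) := by field_simp; ring
            _ = _ := by rw [expadd rfl]; congr 2; ring
        rw [e1, abs_neg, abs_mul, abs_of_pos (exp_pos _)]
        have b3 : |δ * p t * (qi * w t - L * p t)| ≤ 2 * A * K2 / L * exp (7/16 * t) := by
          rw [abs_mul, abs_mul, abs_of_nonneg hδ0, abs_of_pos hp']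
          calc _ ≤ 2/L * (A * exp (1/16 * t)) * (K2 * exp (3/8 * t)) := by gcongr
            _ = 2 * A * K2 / L * (exp (1/16 * t) * exp (3/8 * t)) := by ring
            _ = _ := by rw [expadd rfl]; congr 2; ring
        have b4 : 32 * K * A / L * exp (5/16 * t) ≤ 32 * K * A / L * exp (7/16 * t) := by gcongr; norm_num
        calc _ ≤ exp (-t) * (K3 / L * exp (7/16 * t)) := by
              gcongr
              refine (abs_sub _ _).trans ?_
              rw [hK3, add_div, add_mul]; linarith
          _ = K3 / L * (exp (-t) * exp (7/16 * t)) := by ring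
          _ = K3 / L * exp (-(9/16) * t) := by rw [expadd rfl]; congr 2; ring
          _ ≤ _ := by apply le_of_eq; ring)
    set G := fun z => y z * p z - rho β z * w z * p1 z - 1 + δ * L * E z
    have h2 : |G z| ≤ |G z - G R0| + |G R0| := by
      have := abs_add_le (G z - G R0) (G R0); rwa [sub_add_cancel] at this
    have h3 : exp (-(9/16) * R0) ≤ 1 := by rw [exp_le_one_iff]; linarith [T.hR1]
    have h4 : 0 ≤ K3/L := by positivity
    have h5 : 0 < exp (-(9/16) * z) := exp_pos _
    have h6 : |G R0| ≤ K/L := hG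
    have h7 : |G z| ≤ K/L + 2 * (K3/L) := by nlinarith
    calc _ ≤ K/L + 2 * (K3/L) := h7
      _ = _ := by ring
  have hlim : Tendsto (fun z => |y z * p z - rho β z * w z * p1 z - 1 + δ * L * E z|) atTop (𝓝 |0 - 1 + δ * L * 1|) := by
    have hJ0 : Tendsto (fun z => y z * p z - rho β z * w z * p1 z) atTop (𝓝 0) := by
      have : Tendsto (fun z => Y * exp (-(9/16) * z)) atTop (𝓝 (Y * 0)) := by
        refine Tendsto.const_mul Y (tendsto_exp_atBot.comp ?_)
        exact tendsto_id.const_mul_atTop_of_neg (by norm_num)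
      rw [mul_zero] at this
      refine squeeze_zero_norm' ?_ this
      filter_upwards [eventually_ge_atTop R0] with z hz using hY z hz
    exact ((hJ0.sub_const 1).add (hE1.const_mul _)).abs
  have := le_of_tendsto hlim (by filter_upwards [eventually_ge_atTop R0] with z hz using hGz z hz)
  rwa [show 0 - 1 + δ * L * 1 = δ * L - 1 by ring] at this
end Tail

structure Sol (n : ℕ) (C0 lam β δ : ℝ) (W y : ℝ → ℝ) : Prop where
  hβ : 0 < β
  hL : 1 ≤ -log β
  hδ0 : 0 ≤ δ
  hδ : δ ≤ 2/(-log β)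
  hW : ∀ z, 0 < z → HasDerivAt W (exp z * (z/(z+β)^2) * y z) z
  hy : ∀ z, 0 < z → HasDerivAt y (-((n+δ) * (((z/(z+β))^2)⁻¹ * exp (-z) * W z))) z
  ht : Tendsto y (𝓝[>] 0) (𝓝 1)
  hb : ∀ z, 0 < z → |W z - ell β z * (lagP n).eval z| ≤ C0 * (z/(z+β))^2 * exp (lam * z)

noncomputable def EE1 (n : ℕ) (z : ℝ) : ℝ := ∫ t in (0:ℝ)..z, exp (-t) * ((lagP n).eval t)^2

lemma EE1_deriv (n : ℕ) (z : ℝ) : HasDerivAt (EE1 n) (exp (-z) * ((lagP n).eval z)^2) z := by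
  have hc : Continuous (fun t => exp (-t) * ((lagP n).eval t)^2) := by fun_prop
  exact intervalIntegral.integral_hasDerivAt_right (hc.intervalIntegrable _ _) (hc.stronglyMeasurableAtFilter _ _) hc.continuousAt

lemma EE1_tendsto (n : ℕ) : Tendsto (EE1 n) atTop (𝓝 1) := by
  have h := intervalIntegral_tendsto_integral_Ioi (f := fun t => exp (-t) * ((lagP n).eval t)^2) (μ := volume) 0 (by
    have := poly_integrable ((lagP n)^2)
    simpa only [eval_pow] using this) tendsto_id
  rw [lagP_norm] at h
  exact h

lemma sqrt_log {β : ℝ} (hβ : 0 < β) : √β * (-log β) ≤ 2 := by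
  have h := log_le_sub_one_of_pos (inv_pos.2 (sqrt_pos.2 hβ))
  rw [log_inv, log_sqrt hβ.le] at h
  have hs := sqrt_pos.2 hβ
  have : √β * ((√β)⁻¹ - 1) = 1 - √β := by field_simp
  nlinarith

lemma one_add_log_le {s : ℝ} (hs : 0 < s) : 1 + log s ≤ 2 * √s := by
  have h := log_le_sub_one_of_pos (sqrt_pos.2 hs)
  rw [log_sqrt hs.le] at h
  linarith

lemma kap_sqrt {β z : ℝ} (hβ : 0 < β) (hL : 1 ≤ -log β) (hz : 0 < z) :
    2*β/(z+β) * (1 + log (1 + z/β)) ≤ 8/(-log β)/√z := by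
  have h1 := one_add_log_le (by positivity : 0 < 1 + z/β)
  have h2 : √(1+z/β) = √(z+β)/√β := by
    rw [← sqrt_div (by positivity)]; congr 1; field_simp; ring
  have hsz := sqrt_pos.2 hz
  have hsb := sqrt_pos.2 hβ
  have hszb : 0 < √(z+β) := sqrt_pos.2 (by positivity)
  have h3 := sqrt_log hβ
  have h4 : √z ≤ √(z+β) := sqrt_le_sqrt (by linarith)
  have e1 : z + β = √(z+β)^2 := (sq_sqrt (by positivity)).symm
  have e2 : β = √β^2 := (sq_sqrt hβ.le).symm
  calc 2*β/(z+β) * (1 + log (1 + z/β)) ≤ 2*β/(z+β) * (2 * √(1+z/β)) := by gcongr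
    _ = 4 * √β / √(z+β) := by
      rw [h2]
      generalize √(z+β) = s at *
      rw [e1]
      generalize √β = r at *
      rw [e2]
      field_simp
      ring
    _ ≤ 4 * √β/√z := by gcongr
    _ ≤ 8/(-log β)/√z := by
      gcongr
      rw [le_div_iff₀ (by linarith)]
      linarith

namespace Sol
variable {n : ℕ} {C0 lam β δ : ℝ} {W y : ℝ → ℝ}

lemma J_deriv (S : Sol n C0 lam β δ W y) {z : ℝ} (hz : 0 < z) :
    HasDerivAt (fun z => y z * (lagP n).eval z - rho β z * W z * (derivative (lagP n)).eval z)
      (-(rho β z / z * W z * (δ * (lagP n).eval z - 2*β/(z+β) * (derivative (lagP n)).eval z))) z := by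
  have hβ := S.hβ
  have h1 := S.hW z hz
  have h2 := S.hy z hz
  rw [rho_inv hβ hz] at h1
  rw [rho_c hβ hz] at h2
  have hr := rho_pos hβ hz
  have := (h2.mul ((lagP n).hasDerivAt z)).sub (((rho_deriv hβ hz).mul h1).mul ((derivative (lagP n)).hasDerivAt z))
  refine this.congr_deriv ?_
  simp only [Pi.mul_apply]
  have o := congrArg (eval z) (lagP_facts n).1
  simp only [eval_add, eval_mul, eval_X, eval_sub, eval_one, eval_C, eval_zero] at o
  have o' : (derivative (derivative (lagP n))).eval z = (-(1 - z) * (derivative (lagP n)).eval z - n * (lagP n).eval z)/z := by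
    field_simp; linarith
  rw [o']
  generalize 2*β/(z+β) = k
  field_simp
  ring

lemma β1 (S : Sol n C0 lam β δ W y) : β ≤ 1 := by
  by_contra h; push Not at h
  have := log_pos h; linarith [S.hL]

lemma err (S : Sol n C0 lam β δ W y) (hC0 : 0 < C0) (hlam : 1 ≤ lam) {z R : ℝ} (hz : 0 < z) (hR : z ≤ R) :
    |((z/(z+β))^2)⁻¹ * (W z - ell β z * (lagP n).eval z)| ≤ C0 * exp (lam * R) := by
  have hβ := S.hβ
  rw [abs_mul, abs_of_pos (by positivity : 0 < ((z/(z+β))^2)⁻¹)]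
  rw [inv_mul_le_iff₀ (by positivity)]
  refine (S.hb z hz).trans ?_
  have : exp (lam * z) ≤ exp (lam * R) := exp_le_exp.2 (by nlinarith)
  calc _ ≤ C0 * (z/(z+β))^2 * exp (lam * R) := by gcongr
    _ = _ := by ring

lemma J_tendsto (S : Sol n C0 lam β δ W y) (hC0 : 0 < C0) (hlam : 1 ≤ lam) :
    Tendsto (fun z => y z * (lagP n).eval z - rho β z * W z * (derivative (lagP n)).eval z) (𝓝[>] 0) (𝓝 1) := by
  have hβ := S.hβ
  have c1 : Continuous (fun z => (lagP n).eval z) := by fun_prop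
  have t1 := (c1.tendsto 0).mono_left (nhdsWithin_le_nhds (s := Ioi 0))
  simp only [lagP_zero_eval] at t1
  have t2 : Tendsto (fun z => rho β z * W z * (derivative (lagP n)).eval z) (𝓝[>] 0) (𝓝 0) := by
    have c : Continuous (fun z => z * ((1 + z/β) * |(lagP n).eval z| + C0 * exp (lam * z)) * |(derivative (lagP n)).eval z|) := by
      fun_prop
    have := (c.tendsto 0).mono_left (nhdsWithin_le_nhds (s := Ioi 0))
    simp only [zero_mul] at this
    refine squeeze_zero_norm' ?_ this
    filter_upwards [self_mem_nhdsWithin] with z hz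
    have hz : 0 < z := hz
    rw [norm_eq_abs, abs_mul]
    gcongr
    have e : rho β z * W z = z * exp (-z) * ((((z/(z+β))^2)⁻¹ * ell β z) * (lagP n).eval z +
      ((z/(z+β))^2)⁻¹ * (W z - ell β z * (lagP n).eval z)) := by
      have := rho_c hβ hz
      have e : rho β z = z * exp (-z) * ((z/(z+β))^2)⁻¹ := by
        have h3 : rho β z = z * (rho β z / z) := by field_simp
        rw [h3, ← this]; ring
      rw [e]; ring
    have h2 := ell_upper hβ hz
    have h2' : 0 ≤ ((z/(z+β))^2)⁻¹ * ell β z := mul_nonneg (by positivity) (ell_nonneg hβ hz)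
    have h3 : log (1 + z/β) ≤ z/β := by
      have := log_le_sub_one_of_pos (by positivity : 0 < 1 + z/β); linarith
    have h4 : exp (-z) ≤ 1 := by rw [exp_le_one_iff]; linarith
    rw [e, abs_mul, abs_of_pos (by positivity : 0 < z * exp (-z))]
    calc _ ≤ z * 1 * ((1 + z/β) * |(lagP n).eval z| + C0 * exp (lam * z)) := by
          gcongr
          refine (abs_add_le _ _).trans (add_le_add ?_ (S.err hC0 hlam hz le_rfl))
          rw [abs_mul, abs_of_nonneg h2']
          gcongr
          linarith
      _ = _ := by ring
  have := (S.ht.mul t1).sub t2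
  simpa using this

lemma near (S : Sol n C0 lam β δ W y) (hC0 : 0 < C0) (hlam : 1 ≤ lam) {R M : ℝ} (hR : 1 ≤ R) (hM : 0 < M)
    (hP : ∀ t, 0 ≤ t → t ≤ R → |(lagP n).eval t| ≤ M) (hP1 : ∀ t, 0 ≤ t → t ≤ R → |(derivative (lagP n)).eval t| ≤ M) :
    |y R * (lagP n).eval R - rho β R * W R * (derivative (lagP n)).eval R - 1 + δ * (-log β) * EE1 n R| ≤
      (2 * √R * (C0 * exp (lam * R) * (2 * M * √R + 8 * M) + 2 * (2 + (1 + R) * √R) * M^2 + 8 * M^2)) / (-log β) := by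
  have hβ := S.hβ
  have hL := S.hL
  have hδL := S.hδ
  have hβ1 := S.β1
  have hks := fun z hz => kap_sqrt (z := z) hβ hL hz
  have hlu := fun z hz => log_upper (z := z) hβ hβ1 hz
  have hll := fun z hz => ell_lower (z := z) hβ hz
  have hδ0 := S.hδ0
  set L := -log β with hLd
  have hLp : 0 < L := by linarith
  set K1 := C0 * exp (lam * R) with hK1
  have hK1p : 0 < K1 := by positivity
  set KK := K1 * (2 * M * √R + 8 * M) + 2 * (2 + (1 + R) * √R) * M^2 + 8 * M^2 with hKK
  set G := fun z => y z * (lagP n).eval z - rho β z * W z * (derivative (lagP n)).eval z - 1 + δ * L * EE1 n z with hG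
  have hGd : ∀ z, 0 < z → HasDerivAt G (-(rho β z / z * W z * (δ * (lagP n).eval z - 2*β/(z+β) * (derivative (lagP n)).eval z))
      + δ * L * (exp (-z) * ((lagP n).eval z)^2)) z := fun z hz =>
    ((S.J_deriv hz).sub_const 1).add ((EE1_deriv n z).const_mul (δ * L))
  have hgd : ∀ z, 0 < z → HasDerivAt (fun z => 2 * KK / L * √z) (KK / L / √z) z := fun z hz =>
    ((hasDerivAt_sqrt hz.ne').const_mul (2 * KK / L)).congr_deriv (by
      have := sqrt_pos.2 hz; field_simp)
  have hcmp : ∀ z, 0 < z → z ≤ R → |-(rho β z / z * W z * (δ * (lagP n).eval z - 2*β/(z+β) * (derivative (lagP n)).eval z))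
      + δ * L * (exp (-z) * ((lagP n).eval z)^2)| ≤ KK / L / √z := by
    intro z hz hzR
    have hp := hP z hz.le hzR
    have hp1 := hP1 z hz.le hzR
    have herr := S.err hC0 hlam hz hzR
    have hsz := sqrt_pos.2 hz
    have hsR : √z ≤ √R := sqrt_le_sqrt hzR
    set P := (lagP n).eval z
    set P1 := (derivative (lagP n)).eval z
    set k := 2*β/(z+β) with hk
    have hk0 : 0 ≤ k := by positivity
    set qi := ((z/(z+β))^2)⁻¹ with hqi
    have hq1 : 1 ≤ qi := by
      have : qi = (1 + β/z)^2 := by rw [hqi]; field_simp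
      have : 0 < β/z := by positivity
      nlinarith
    have hl0 := ell_nonneg hβ hz
    have hq := ell_upper hβ hz
    set l := ell β z
    have hlog0 : 0 ≤ log (1 + z/β) := log_nonneg (by have : 0 < z/β := by positivity
                                                     linarith)
    have hk1 : k * (qi * l) ≤ 8/L/√z := (mul_le_mul_of_nonneg_left hq hk0).trans (hks z hz)
    have hk2 : k ≤ 8/L/√z := le_trans (le_mul_of_one_le_right hk0 (by linarith)) (hks z hz)
    have one_le : 1 ≤ √R/√z := by rwa [le_div_iff₀ hsz, one_mul]
    have hqL : |qi * l - L| ≤ (2 + (1+R) * √R)/√z := by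
      rw [abs_le]
      constructor
      · have h1 : -log z ≤ 2/√z - 2 := by
          have h := one_add_log_le (inv_pos.2 hz)
          rw [log_inv, sqrt_inv] at h
          have h' := log_le_sub_one_of_pos (inv_pos.2 hsz)
          rw [log_inv, log_sqrt hz.le] at h'
          rw [div_eq_mul_inv]; linarith
        have h2 := hll z hz
        have h3 : l ≤ qi * l := le_mul_of_one_le_left hl0 hq1
        have h4 : 0 ≤ (1+R) * √R / √z := by positivity
        rw [add_div]
        linarith
      · have h2 := hlu z hz
        have h3 : (1 + R) * 1 ≤ (1+R) * (√R/√z) := by gcongr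
        have h4 : 0 < 2/√z := by positivity
        rw [add_div, mul_div_assoc]
        linarith
    rw [← rho_c hβ hz]
    have e1 : -(qi * exp (-z) * W z * (δ * P - k * P1)) + δ * L * (exp (-z) * P ^2)
      = -(exp (-z) * (qi * (W z - l * P) * (δ * P - k * P1) + (qi * l - L) * δ * P^2 - k * (qi * l) * P * P1)) := by ring
    rw [e1, abs_neg, abs_mul, abs_of_pos (exp_pos _)]
    have he1 : exp (-z) ≤ 1 := by rw [exp_le_one_iff]; linarith
    have b1 : |qi * (W z - l * P) * (δ * P - k * P1)| ≤ K1 * (2 * M * √R + 8 * M) / L / √z := by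
      rw [abs_mul]
      have : |δ * P - k * P1| ≤ (2 * M * √R + 8 * M) / L / √z := by
        refine (abs_sub _ _).trans ?_
        rw [abs_mul, abs_mul, abs_of_nonneg hδ0, abs_of_nonneg hk0]
        have c1 : δ * |P| ≤ 2/L * M * (√R/√z) := by
          calc δ * |P| ≤ 2/L * M * 1 := by rw [mul_one]; gcongr
            _ ≤ _ := by gcongr
        have c2 : k * |P1| ≤ 8/L/√z * M := by gcongr
        have e : (2 * M * √R + 8 * M) / L / √z = 2/L * M * (√R/√z) + 8/L/√z * M := by ring
        rw [e]; linarith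
      calc _ ≤ K1 * ((2 * M * √R + 8 * M) / L / √z) := by gcongr
        _ = _ := by ring
    have b2 : |(qi * l - L) * δ * P^2| ≤ 2 * (2 + (1+R) * √R) * M^2/L/√z := by
      rw [abs_mul, abs_mul, abs_of_nonneg hδ0, abs_pow]
      calc _ ≤ (2 + (1+R) * √R)/√z * (2/L) * M^2 := by gcongr
        _ = _ := by ring
    have b3 : |k * (qi * l) * P * P1| ≤ 8 * M^2/L/√z := by
      have : 0 ≤ k * (qi * l) := by positivity
      rw [abs_mul, abs_mul, abs_of_nonneg this]
      calc _ ≤ 8/L/√z * M * M := by gcongr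
        _ = _ := by ring
    have e3 : KK / L / √z = K1 * (2 * M * √R + 8 * M) / L / √z + 2 * (2 + (1+R) * √R) * M^2/L/√z + 8 * M^2/L/√z := by
      rw [hKK]; ring
    refine (mul_le_of_le_one_left (abs_nonneg _) he1).trans ?_
    rw [e3]
    refine (abs_sub _ _).trans (add_le_add ((abs_add_le _ _).trans (add_le_add b1 b2)) b3)
  have hG0 : Tendsto (fun z => |G R - G z|) (𝓝[>] 0) (𝓝 |G R - (1 - 1 + δ * L * 0)|) := by
    have hE : Tendsto (EE1 n) (𝓝[>] 0) (𝓝 0) := by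
      have := ((EE1_deriv n 0).continuousAt.tendsto).mono_left (nhdsWithin_le_nhds (s := Ioi 0))
      simpa [EE1] using this
    exact ((((S.J_tendsto hC0 hlam).sub_const 1).add (hE.const_mul (δ * L))).const_sub (G R)).abs
  have hfin := le_of_tendsto hG0 (b := 2 * KK / L * √R) (by
    filter_upwards [Ioo_mem_nhdsGT (by linarith : (0:ℝ) < R)] with ε hε
    have := cmp_abs hε.2.le (fun t ht => hGd t (hε.1.trans_le ht.1)) (fun t ht => hgd t (hε.1.trans_le ht.1))
      (fun t ht => hcmp t (hε.1.trans_le ht.1) ht.2)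
    refine this.trans ?_
    have : 0 ≤ 2 * KK / L * √ε := by positivity
    linarith)
  rw [show G R - (1 - 1 + δ * L * 0) = G R by ring] at hfin
  refine hfin.trans (le_of_eq ?_)
  ring
end Sol

set_option maxHeartbeats 1600000 in
lemma main_exists (n : ℕ) : ∃ C L0 R0 : ℝ, 0 < C ∧ 1 ≤ L0 ∧ 1 ≤ R0 ∧ ∀ β : ℝ, 0 < β → L0 ≤ -log β →
    ∃ δ : ℝ, |δ * (-log β) - 1| ≤ C / (-log β) ∧ ∃ W y : ℝ → ℝ,
      (∀ z, 0 < z → HasDerivAt W (exp z * (z/(z+β)^2) * y z) z) ∧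
      (∀ z, 0 < z → HasDerivAt y (-((n+δ) * (((z/(z+β))^2)⁻¹ * exp (-z) * W z))) z) ∧
      Tendsto y (𝓝[>] 0) (𝓝 1) ∧
      ∃ Y : ℝ, 0 ≤ Y ∧ ∀ z, R0 ≤ z → |y z| ≤ Y * exp (-(3/4) * z) := by
  obtain ⟨C0, lam, hC0, hlam, hsol⟩ := exists_sol n
  obtain ⟨A1, hA1, hP⟩ := poly_exp_bound (lagP n) (1/16) (by norm_num)
  obtain ⟨A2, hA2, hP1⟩ := poly_exp_bound (derivative (lagP n)) (1/16) (by norm_num)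
  obtain ⟨R1, hR1⟩ := lagP_eventually n
  obtain ⟨R2, hR2⟩ := eventually_atTop.1 ((EE1_tendsto n).eventually (eventually_ge_nhds (by norm_num : (3/4:ℝ) < 1)))
  set A := A1 + A2 with hA
  have hAp : 0 < A := by positivity
  set R0 := max (max R1 R2) (max 1 (16*((n:ℝ)+3)/3)) with hR0
  have hR01 : 1 ≤ R0 := (le_max_left _ _).trans (le_max_right _ _)
  have hR03 : 16*((n:ℝ)+3)/3 ≤ R0 := (le_max_right _ _).trans (le_max_right _ _)
  have hR0a : R1 ≤ R0 := (le_max_left _ _).trans (le_max_left _ _)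
  have hR0b : R2 ≤ R0 := (le_max_right _ _).trans (le_max_left _ _)
  set M := A * exp (1/16 * R0) with hM
  have hMp : 0 < M := by positivity
  have hPM : ∀ t, 0 ≤ t → t ≤ R0 → |(lagP n).eval t| ≤ M := fun t h1 h2 => (hP t h1).trans (by
    rw [hM, hA]; gcongr; linarith)
  have hPM1 : ∀ t, 0 ≤ t → t ≤ R0 → |(derivative (lagP n)).eval t| ≤ M := fun t h1 h2 => (hP1 t h1).trans (by
    rw [hM, hA]; gcongr; linarith)
  set KN := 2 * √R0 * (C0 * exp (lam * R0) * (2 * M * √R0 + 8 * M) + 2 * (2 + (1 + R0) * √R0) * M^2 + 8 * M^2) with hKN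
  have hKNp : 0 ≤ KN := by positivity
  set K1 := C0 * exp (lam * R0) with hK1
  have hK1p : 0 < K1 := by positivity
  set K := KN + (1 + R0) * M + (1 + R0) + K1 with hK
  have hKp : 0 < K := by positivity
  set s : ℝ := (-1)^n with hs
  have hs2 : s * s = 1 := by rw [hs, ← pow_add, ← two_mul, pow_mul]; norm_num
  have hsabs : |s| = 1 := by rw [hs, abs_pow]; norm_num
  set CC := (K + 2 * (2 * A * (3 * K + A * (K + 77 * K * A)) + 32 * K * A)) with hCC
  refine ⟨CC, 2 + K1 + 4 * KN, R0, by positivity, by linarith, hR01, ?_⟩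
  intro β hβ hL0
  have hL : 1 ≤ -log β := by linarith
  obtain ⟨W, y, hWc, hWy⟩ := hsol β hβ hL
  set L := -log β with hLd
  have hLp : 0 < L := by linarith
  have S : ∀ δ ∈ Icc 0 (2/L), Sol n C0 lam β δ (W δ) (y δ) := fun δ hδ =>
    ⟨hβ, hL, hδ.1, hδ.2, (hWy δ hδ).1, (hWy δ hδ).2.1, (hWy δ hδ).2.2.1, (hWy δ hδ).2.2.2⟩
  have T : ∀ δ ∈ Icc 0 (2/L), Tail n A R0 β δ (fun z => s * (lagP n).eval z) (fun z => s * (derivative (lagP n)).eval z)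
      (fun z => s * W δ z) (fun z => s * y δ z) := by
    intro δ hδ
    have hz0 : ∀ z, R0 ≤ z → 0 < z := fun z hz => by linarith
    refine ⟨hβ, hL, hδ.1, hδ.2, hR01, hR03, hAp, ?_, ?_, ?_, ?_, ?_, ?_, ?_, ?_⟩
    · intro z hz
      have h := ((S δ hδ).hW z (hz0 z hz)).const_mul s
      rw [rho_inv hβ (hz0 z hz)] at h
      exact h.congr_deriv (by ring)
    · intro z hz
      have h := ((S δ hδ).hy z (hz0 z hz)).const_mul s
      rw [rho_c hβ (hz0 z hz)] at h
      exact h.congr_deriv (by ring)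
    · intro z hz
      have h := ((S δ hδ).J_deriv (hz0 z hz)).const_mul (s * s)
      refine (h.congr_of_eventuallyEq (Eventually.of_forall fun t => ?_)).congr_deriv ?_
      · simp only; ring
      · ring
    · intro z hz
      exact ((lagP n).hasDerivAt z).const_mul s
    · exact fun z hz => (hR1 z (hR0a.trans hz)).1
    · exact fun z hz => (hR1 z (hR0a.trans hz)).2.1
    · exact fun z hz => (hR1 z (hR0a.trans hz)).2.2
    · intro z hz
      have h1 : s * (lagP n).eval z ≤ |(lagP n).eval z| := by
        refine (le_abs_self _).trans ?_
        rw [abs_mul, hsabs, one_mul]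
      refine (h1.trans (hP z (hz0 z hz).le)).trans ?_
      rw [hA]; gcongr; linarith
  have hR0p : 0 < R0 := by linarith
  have hE34 : 3/4 ≤ EE1 n R0 := hR2 R0 hR0b
  have hβ1 : β ≤ 1 := by
    by_contra h; push Not at h
    have := log_pos h; linarith
  have hp1 : 1 ≤ s * (lagP n).eval R0 := (hR1 R0 hR0a).1
  have hpM : s * (lagP n).eval R0 ≤ M := by
    refine (le_abs_self _).trans ?_
    rw [abs_mul, hsabs, one_mul]; exact hPM R0 hR0p.le le_rfl
  have hl1 : L - 1 ≤ ell β R0 := by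
    have h1 := ell_lower hβ hR0p
    have := log_nonneg hR01
    linarith
  have hl2 : ell β R0 ≤ L + R0 := by
    have h1 := log_upper hβ hβ1 hR0p
    have : 0 < R0/(R0+β) := by positivity
    unfold ell; linarith
  have herr : ∀ δ ∈ Icc 0 (2/L), |s * W δ R0 - ell β R0 * (s * (lagP n).eval R0)| ≤ K1 := by
    intro δ hδ
    have h1 := (S δ hδ).hb R0 hR0p
    have e : s * W δ R0 - ell β R0 * (s * (lagP n).eval R0) = s * (W δ R0 - ell β R0 * (lagP n).eval R0) := by ring
    rw [e, abs_mul, hsabs, one_mul]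
    refine h1.trans ?_
    have h2 : R0/(R0+β) ≤ 1 := by rw [div_le_one (by positivity)]; linarith
    calc _ ≤ C0 * 1^2 * exp (lam * R0) := by gcongr
      _ = _ := by rw [hK1]; ring
  have hwpos : ∀ δ ∈ Icc 0 (2/L), 0 < s * W δ R0 := by
    intro δ hδ
    have h1 := (abs_le.1 (herr δ hδ)).1
    have h2 : ell β R0 * 1 ≤ ell β R0 * (s * (lagP n).eval R0) :=
      mul_le_mul_of_nonneg_left hp1 (ell_nonneg hβ hR0p)
    linarith
  have hwK : ∀ δ ∈ Icc 0 (2/L), |s * W δ R0| ≤ K * L := by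
    intro δ hδ
    rw [abs_of_pos (hwpos δ hδ)]
    have h1 := (abs_le.1 (herr δ hδ)).2
    have h2 : ell β R0 * (s * (lagP n).eval R0) ≤ (L + R0) * M := by
      have : 0 ≤ ell β R0 := ell_nonneg hβ hR0p
      gcongr
    have h3 : (L + R0) * M ≤ (1 + R0) * M * L := by
      have h0 : R0 * 1 ≤ R0 * L := mul_le_mul_of_nonneg_left hL hR0p.le
      have h1 : L + R0 ≤ (1 + R0) * L := by linarith
      calc (L + R0) * M ≤ ((1 + R0) * L) * M := mul_le_mul_of_nonneg_right h1 hMp.le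
        _ = _ := by ring
    have h4 : K1 ≤ K1 * L := le_mul_of_one_le_right hK1p.le hL
    have h5 : 0 ≤ (KN + (1 + R0)) * L := by positivity
    have h6 : K * L = (1 + R0) * M * L + K1 * L + (KN + (1 + R0)) * L := by rw [hK]; ring
    linarith
  have hqK : ∀ δ ∈ Icc 0 (2/L), |s * W δ R0 / (s * (lagP n).eval R0) - L| ≤ K := by
    intro δ hδ
    have hpp : 0 < s * (lagP n).eval R0 := by linarith
    have e : s * W δ R0 / (s * (lagP n).eval R0) - L = (s * W δ R0 - ell β R0 * (s * (lagP n).eval R0))/(s * (lagP n).eval R0) + (ell β R0 - L) := by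
      rw [sub_div, mul_div_cancel_right₀ _ hpp.ne']; ring
    rw [e]
    have h1 : |(s * W δ R0 - ell β R0 * (s * (lagP n).eval R0))/(s * (lagP n).eval R0)| ≤ K1 := by
      rw [abs_div, abs_of_pos hpp]
      exact (div_le_self (abs_nonneg _) hp1).trans (herr δ hδ)
    have h2 : |ell β R0 - L| ≤ 1 + R0 := by rw [abs_le]; constructor <;> linarith
    have h3 : 0 ≤ (1 + R0) * M := by positivity
    refine (abs_add_le _ _).trans ?_
    linarith
  have hJeq : ∀ δ, s * y δ R0 * (s * (lagP n).eval R0) - rho β R0 * (s * W δ R0) * (s * (derivative (lagP n)).eval R0)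
      = y δ R0 * (lagP n).eval R0 - rho β R0 * W δ R0 * (derivative (lagP n)).eval R0 := by
    intro δ
    calc _ = (s * s) * (y δ R0 * (lagP n).eval R0 - rho β R0 * W δ R0 * (derivative (lagP n)).eval R0) := by ring
      _ = _ := by rw [hs2, one_mul]
  have hnear : ∀ δ ∈ Icc 0 (2/L), |s * y δ R0 * (s * (lagP n).eval R0) - rho β R0 * (s * W δ R0) * (s * (derivative (lagP n)).eval R0) - 1 + δ * L * EE1 n R0| ≤ KN / L := by
    intro δ hδ
    rw [hJeq]
    exact (S δ hδ).near hC0 hlam hR01 hMp hPM hPM1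
  have hKN4 : KN / L ≤ 1/4 := by rw [div_le_iff₀ hLp]; linarith
  have h2L : 0 ≤ 2/L := by positivity
  have m0 : (0:ℝ) ∈ Icc 0 (2/L) := ⟨le_rfl, h2L⟩
  have m2 : 2/L ∈ Icc 0 (2/L) := ⟨h2L, le_rfl⟩
  have hU0 : Up R0 (fun z => s * W 0 z) := by
    refine (T 0 m0).up0 (hwpos 0 m0) ?_
    have := (abs_le.1 (hnear 0 m0)).1
    simp only [zero_mul, add_zero] at this
    linarith
  have hD2 : Dn R0 (fun z => s * W (2/L) z) := by
    refine (T (2/L) m2).dn0 (hwpos _ m2) ?_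
    have h1 := (abs_le.1 (hnear _ m2)).2
    have e : 2/L * L = 2 := by field_simp
    rw [e] at h1
    linarith
  -- connectedness
  set cl : ℝ → ℝ := fun δ => max 0 (min δ (2/L)) with hcl
  have hclm : ∀ δ, cl δ ∈ Icc 0 (2/L) := fun δ => ⟨le_max_left _ _, max_le h2L (min_le_right _ _)⟩
  have hclc : Continuous cl := by fun_prop
  have hWcl : ∀ z, 0 < z → Continuous (fun δ => s * W (cl δ) z) := fun z hz =>
    ((hWc z hz).comp_continuous hclc hclm).const_mul s
  have hucl : ∀ z, 0 < z → Continuous (fun δ => uu (fun z => s * W (cl δ) z) z) := fun z hz =>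
    ((hWcl z hz).pow 2).mul continuous_const
  have hUo : IsOpen {δ | Up R0 (fun z => s * W (cl δ) z)} := by
    rw [isOpen_iff_mem_nhds]
    rintro δ ⟨a, b, ha, hab, hu, hw⟩
    have ha0 : 0 < a := by linarith
    have hb0 : 0 < b := by linarith
    filter_upwards [(isOpen_lt (hucl a ha0) (hucl b hb0)).mem_nhds hu, (isOpen_lt continuous_const (hWcl b hb0)).mem_nhds hw] with x h1 h2
    exact ⟨a, b, ha, hab, h1, h2⟩
  have hDo : IsOpen {δ | Dn R0 (fun z => s * W (cl δ) z)} := by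
    rw [isOpen_iff_mem_nhds]
    rintro δ ⟨a, b, ha, hab, hu, hw⟩
    have ha0 : 0 < a := by linarith
    have hb0 : 0 < b := by linarith
    filter_upwards [(isOpen_lt (hucl a ha0) (hucl b hb0)).mem_nhds hu, (isOpen_lt (hWcl b hb0) continuous_const).mem_nhds hw] with x h1 h2
    exact ⟨a, b, ha, hab, h1, h2⟩
  have hc0 : cl 0 = 0 := by simp [hcl, h2L]
  have hc2 : cl (2/L) = 2/L := by simp [hcl, h2L]
  obtain ⟨δ, hδ, hnU, hnD⟩ : ∃ δ ∈ Icc 0 (2/L), ¬ Up R0 (fun z => s * W δ z) ∧ ¬ Dn R0 (fun z => s * W δ z) := by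
    by_contra hcon
    push Not at hcon
    obtain ⟨x, -, hx1, hx2⟩ := isPreconnected_univ (α := ℝ) _ _ hUo hDo (fun δ _ => by
      by_cases h : Up R0 (fun z => s * W (cl δ) z)
      · exact Or.inl h
      · exact Or.inr (hcon (cl δ) (hclm δ) h)) ⟨0, mem_univ _, by simpa only [mem_setOf_eq, hc0] using hU0⟩
      ⟨2/L, mem_univ _, by simpa only [mem_setOf_eq, hc2] using hD2⟩
    exact (T _ (hclm x)).disj hx1 hx2
  have hTh := (T δ hδ).trich hnU hnD
  have hβ2 : β * L^2 ≤ 4 := by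
    have h := sqrt_log hβ
    have e2 : β = √β^2 := (sq_sqrt hβ.le).symm
    have h0 : 0 ≤ √β * L := by positivity
    calc β * L^2 = (√β * L)^2 := by rw [mul_pow, ← e2]
      _ ≤ 2^2 := by gcongr
      _ = 4 := by norm_num
  refine ⟨δ, ?_, W δ, y δ, (S δ hδ).hW, (S δ hδ).hy, (S δ hδ).ht, ?_⟩
  · refine (T δ hδ).asym hTh hKp.le (E := EE1 n) hβ2 (hwK δ hδ) (hqK δ hδ) ?_ (EE1_tendsto n) ?_
    · intro z hz
      refine (EE1_deriv n z).congr_deriv ?_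
      rw [mul_pow, sq s, hs2, one_mul]
    · refine (hnear δ hδ).trans ?_
      have : KN ≤ K := by
        have h3 : 0 ≤ (1 + R0) * M := by positivity
        linarith
      gcongr
  · obtain ⟨Y, hY, h⟩ := (T δ hδ).y_decay hTh
    refine ⟨Y, hY, fun z hz => ?_⟩
    have := h z hz
    rwa [abs_mul, hsabs, one_mul] at this

end Helpers

section Final
open Filter Topology

lemma smooth_sys {β ν : ℝ} (hβ : 0 < β) {W y : ℝ → ℝ}
    (hW : ∀ z, 0 < z → HasDerivAt W (exp z * (z/(z+β)^2) * y z) z)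
    (hy : ∀ z, 0 < z → HasDerivAt y (-(ν * (((z/(z+β))^2)⁻¹ * exp (-z) * W z))) z) (k : ℕ) :
    ContDiffOn ℝ k W (Ioi 0) ∧ ContDiffOn ℝ k y (Ioi 0) := by
  have hne : ∀ x ∈ Ioi (0:ℝ), x + β ≠ 0 := fun x hx => (add_pos hx hβ).ne'
  induction k with
  | zero =>
    simp only [Nat.cast_zero, contDiffOn_zero]
    exact ⟨fun z hz => (hW z hz).continuousAt.continuousWithinAt, fun z hz => (hy z hz).continuousAt.continuousWithinAt⟩
  | succ k ih =>
    have h1 : ContDiffOn ℝ k (fun z : ℝ => z) (Ioi 0) := contDiffOn_id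
    have h2 : ContDiffOn ℝ k (fun z : ℝ => z + β) (Ioi 0) := h1.add contDiffOn_const
    have c1 : ContDiffOn ℝ k (fun z : ℝ => exp z * (z/(z+β)^2) * y z) (Ioi 0) :=
      (h1.exp.mul (h1.div (h2.pow 2) (fun x hx => pow_ne_zero 2 (hne x hx)))).mul ih.2
    have c2 : ContDiffOn ℝ k (fun z : ℝ => -(ν * (((z/(z+β))^2)⁻¹ * exp (-z) * W z))) (Ioi 0) := by
      refine (contDiffOn_const.mul (((((h1.div h2 hne).pow 2).inv ?_).mul (h1.neg.exp)).mul ih.1)).neg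
      intro x hx
      exact pow_ne_zero 2 (div_ne_zero (ne_of_gt hx) (hne x hx))
    push_cast
    constructor
    · rw [contDiffOn_succ_iff_deriv_of_isOpen isOpen_Ioi]
      exact ⟨fun z hz => (hW z hz).differentiableAt.differentiableWithinAt, by simp,
        c1.congr fun z hz => (hW z hz).deriv⟩
    · rw [contDiffOn_succ_iff_deriv_of_isOpen isOpen_Ioi]
      exact ⟨fun z hz => (hy z hz).differentiableAt.differentiableWithinAt, by simp,
        c2.congr fun z hz => (hy z hz).deriv⟩

noncomputable def FF (β : ℝ) (y : ℝ → ℝ) (z : ℝ) : ℝ := exp z * (z/(z+β)^2) * y z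
noncomputable def HH (β ν : ℝ) (W y : ℝ → ℝ) (z : ℝ) : ℝ :=
  FF β y z * (1 - 2/(z+β) + 1/z) - ν * W z / z

lemma FF_deriv {β ν : ℝ} (hβ : 0 < β) {W y : ℝ → ℝ}
    (hy : ∀ z, 0 < z → HasDerivAt y (-(ν * (((z/(z+β))^2)⁻¹ * exp (-z) * W z))) z) {z : ℝ} (hz : 0 < z) :
    HasDerivAt (FF β y) (HH β ν W y z) z := by
  have hne : z + β ≠ 0 := by positivity
  have h1 : HasDerivAt (fun z : ℝ => (z + β)^2) (2 * (z+β)) z :=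
    (((hasDerivAt_id z).add_const β).pow 2).congr_deriv (by simp)
  have h2 := (((Real.hasDerivAt_exp z).mul ((hasDerivAt_id z).div h1 (pow_ne_zero 2 hne))).mul (hy z hz))
  refine h2.congr_deriv ?_
  unfold HH FF
  simp only [Pi.mul_apply, Pi.div_apply, id]
  rw [exp_neg]
  have := (exp_pos z).ne'
  field_simp
  ring

lemma HH_deriv {β ν : ℝ} (hβ : 0 < β) {W y : ℝ → ℝ}
    (hW : ∀ z, 0 < z → HasDerivAt W (FF β y z) z)
    (hy : ∀ z, 0 < z → HasDerivAt y (-(ν * (((z/(z+β))^2)⁻¹ * exp (-z) * W z))) z) {z : ℝ} (hz : 0 < z) :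
    HasDerivAt (HH β ν W y) (HH β ν W y z * (1 - 2/(z+β) + 1/z) + FF β y z * (2/(z+β)^2 - 1/z^2)
      - ν * FF β y z / z + ν * W z / z^2) z := by
  have hne : z + β ≠ 0 := by positivity
  have h1 : HasDerivAt (fun z : ℝ => 1 - 2/(z+β) + 1/z) (2/(z+β)^2 - 1/z^2) z := by
    have a := ((hasDerivAt_const z (2:ℝ)).div ((hasDerivAt_id z).add_const β) hne).const_sub 1
    have b := (hasDerivAt_const z (1:ℝ)).div (hasDerivAt_id z) hz.ne'
    refine (a.add b).congr_deriv ?_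
    simp only [id]
    ring
  have h2 := ((FF_deriv hβ hy hz).mul h1).sub (((hW z hz).const_mul ν).div (hasDerivAt_id z) hz.ne')
  refine h2.congr_deriv ?_
  simp only [id]
  field_simp
  ring

lemma Q_deriv (r : ℝ) : HasDerivAt Qfun (8 * r / (1 + r^2)^2) r := by
  have h1 : HasDerivAt (fun r : ℝ => 4 * r^2) (8 * r) r :=
    ((hasDerivAt_pow 2 r).const_mul 4).congr_deriv (by norm_num; ring)
  have h2 : HasDerivAt (fun r : ℝ => 1 + r^2) (2 * r) r :=
    ((hasDerivAt_pow 2 r).const_add 1).congr_deriv (by norm_num)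
  have hp : 1 + r^2 ≠ 0 := by positivity
  refine (h1.div h2 hp).congr_deriv ?_
  field_simp
  ring

lemma ode_phi {β ν : ℝ} (hβ : 0 < β) {W y : ℝ → ℝ}
    (hW : ∀ z, 0 < z → HasDerivAt W (FF β y z) z)
    (hy : ∀ z, 0 < z → HasDerivAt y (-(ν * (((z/(z+β))^2)⁻¹ * exp (-z) * W z))) z) {r : ℝ} (hr : 0 < r) :
    A0 (fun r => FF β y (β * r^2)) r - (2*β) * r * deriv (fun r => FF β y (β * r^2)) r
      = 2 * (2*β) * (1 - ν) * FF β y (β * r^2) := by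
  have hz : ∀ r : ℝ, 0 < r → 0 < β * r^2 := fun r hr => by positivity
  have hd : ∀ r : ℝ, HasDerivAt (fun r : ℝ => β * r^2) (2 * β * r) r := fun r =>
    ((hasDerivAt_pow 2 r).const_mul β).congr_deriv (by norm_num; ring)
  have h1 : ∀ r, 0 < r → HasDerivAt (fun r => FF β y (β * r^2)) (HH β ν W y (β * r^2) * (2 * β * r)) r :=
    fun r hr => HasDerivAt.comp (h₂ := FF β y) (h := fun r : ℝ => β * r^2) r (FF_deriv hβ hy (hz r hr)) (hd r)
  have h2 : deriv (fun r => FF β y (β * r^2)) =ᶠ[𝓝 r] fun r => HH β ν W y (β * r^2) * (2 * β * r) := by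
    filter_upwards [isOpen_Ioi.mem_nhds (mem_Ioi.2 hr)] with x hx
    exact (h1 x hx).deriv
  have h3 := (HasDerivAt.comp (h₂ := HH β ν W y) (h := fun r : ℝ => β * r^2) r (HH_deriv hβ hW hy (hz r hr)) (hd r)).mul
    (((hasDerivAt_id r).const_mul (2 * β)).congr_deriv (mul_one (2*β)))
  have h4 := (h3.congr_of_eventuallyEq h2).deriv
  unfold A0
  rw [h4, (h1 r hr).deriv, (Q_deriv r).deriv]
  unfold Qfun
  simp only [id, Function.comp]
  have e : β * r^2 + β = β * (1 + r^2) := by ring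
  unfold HH
  rw [e]
  generalize FF β y (β * r^2) = F
  generalize W (β * r^2) = w
  have hp : 1 + r^2 ≠ 0 := by positivity
  field_simp
  ring

lemma alpha_bound {C L l δ : ℝ} (hC : 0 < C) (hl : 1 ≤ l) (hL : L = Real.log 2 + l)
    (h : |δ * L - 1| ≤ C / L) : |-δ - 1 / (-l)| ≤ (C + 1) / (-l)^2 := by
  have h2 : Real.log 2 ≤ 1 := by have := Real.log_two_lt_d9; linarith
  have h2' : 0 < Real.log 2 := Real.log_pos (by norm_num)
  have hlp : 0 < l := by linarith
  have hLl : l ≤ L := by linarith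
  have hLp : 0 < L := by linarith
  have e : -δ - 1 / (-l) = -((δ * L - 1) / L) + Real.log 2 / (L * l) := by
    have : Real.log 2 = L - l := by linarith
    rw [this]; field_simp; ring
  rw [e]
  have a1 : |-((δ * L - 1) / L)| ≤ C / l^2 := by
    rw [abs_neg, abs_div, abs_of_pos hLp]
    calc |δ * L - 1| / L ≤ (C / L) / L := by gcongr
      _ = C / L^2 := by field_simp
      _ ≤ C / l^2 := by gcongr
  have a2 : |Real.log 2 / (L * l)| ≤ 1 / l^2 := by
    rw [abs_of_pos (by positivity)]
    apply div_le_div₀ zero_le_one h2 (by positivity)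
    nlinarith
  calc _ ≤ _ := abs_add_le _ _
    _ ≤ C / l^2 + 1 / l^2 := add_le_add a1 a2
    _ = _ := by rw [neg_sq]; ring

lemma y_bdd {y : ℝ → ℝ} {R0 : ℝ} (hR : 1 ≤ R0) (hc : ∀ z, 0 < z → ContinuousAt y z)
    (h0 : Tendsto y (𝓝[>] 0) (𝓝 1)) : ∃ B, 0 ≤ B ∧ ∀ z, 0 < z → z ≤ R0 → |y z| ≤ B := by
  have h1 : ∀ᶠ z in 𝓝[>] (0:ℝ), |y z| < 2 :=
    h0.abs.eventually (gt_mem_nhds (by norm_num))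
  obtain ⟨ε, hε, hs⟩ := mem_nhdsGT_iff_exists_Ioo_subset.1 h1
  have hε' : 0 < ε := hε
  obtain ⟨B, hB⟩ := (isCompact_Icc (a := ε) (b := R0)).exists_bound_of_continuousOn
    (f := y) (fun z hz => (hc z (lt_of_lt_of_le hε' hz.1)).continuousWithinAt)
  refine ⟨max 2 B, by positivity, fun z hz hzR => ?_⟩
  by_cases hh : z < ε
  · exact (le_of_lt (hs ⟨hz, hh⟩)).trans (le_max_left _ _)
  · exact (hB z ⟨not_lt.1 hh, hzR⟩).trans (le_max_right _ _)

lemma y_sq_bdd {y : ℝ → ℝ} {R0 Y : ℝ} (hR : 1 ≤ R0) (hc : ∀ z, 0 < z → ContinuousAt y z)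
    (h0 : Tendsto y (𝓝[>] 0) (𝓝 1)) (hY0 : 0 ≤ Y)
    (hY : ∀ z, R0 ≤ z → |y z| ≤ Y * exp (-(3/4) * z)) :
    ∃ D, 0 ≤ D ∧ ∀ z, 0 < z → exp z * y z ^ 2 ≤ D * exp (-(1/2) * z) := by
  obtain ⟨B, hB0, hB⟩ := y_bdd hR hc h0
  refine ⟨Y^2 + B^2 * exp (3/2 * R0), by positivity, fun z hz => ?_⟩
  rcases le_total R0 z with h | h
  · have h1 : y z ^ 2 ≤ Y^2 * exp (-(3/2) * z) := by
      have := pow_le_pow_left₀ (abs_nonneg _) (hY z h) 2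
      rw [sq_abs, mul_pow, ← exp_nat_mul] at this
      have e : ((2:ℕ):ℝ) * (-(3/4) * z) = -(3/2) * z := by push_cast; ring
      rwa [e] at this
    calc exp z * y z ^ 2 ≤ exp z * (Y^2 * exp (-(3/2) * z)) := by gcongr
      _ = Y^2 * exp (-(1/2) * z) := by
        rw [mul_left_comm, ← exp_add]; congr 2; ring
      _ ≤ _ := by
        gcongr
        have : 0 ≤ B^2 * exp (3/2 * R0) := by positivity
        linarith
  · have h1 : y z ^ 2 ≤ B^2 := by
      have := pow_le_pow_left₀ (abs_nonneg _) (hB z hz h) 2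
      rwa [sq_abs] at this
    calc exp z * y z ^ 2 ≤ exp z * B^2 := by gcongr
      _ = B^2 * exp (3/2 * z) * exp (-(1/2) * z) := by
        rw [mul_assoc, ← exp_add, mul_comm]; congr 2; ring
      _ ≤ B^2 * exp (3/2 * R0) * exp (-(1/2) * z) := by gcongr
      _ ≤ _ := by
        gcongr
        have : 0 ≤ Y^2 := by positivity
        linarith

lemma phi_contDiff {β : ℝ} (hβ : 0 < β) {y : ℝ → ℝ} (hy : ContDiffOn ℝ (⊤ : ℕ∞) y (Ioi 0)) :
    ContDiffOn ℝ (⊤ : ℕ∞) (fun r => FF β y (β * r^2)) (Ioi 0) := by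
  have hq : ContDiffOn ℝ (⊤ : ℕ∞) (fun r : ℝ => β * r^2) (Ioi 0) :=
    contDiffOn_const.mul (contDiffOn_id.pow 2)
  have hF : ContDiffOn ℝ (⊤ : ℕ∞) (FF β y) (Ioi 0) := by
    have h1 : ContDiffOn ℝ (⊤ : ℕ∞) (fun z : ℝ => z) (Ioi 0) := contDiffOn_id
    have h2 : ContDiffOn ℝ (⊤ : ℕ∞) (fun z : ℝ => z + β) (Ioi 0) := h1.add contDiffOn_const
    exact (h1.exp.mul (h1.div (h2.pow 2)
      (fun x hx => pow_ne_zero 2 (add_pos hx hβ).ne'))).mul hy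
  refine hF.comp hq (fun r hr => ?_)
  have : 0 < r := hr
  exact mem_Ioi.2 (by positivity)

lemma phi_weight {β : ℝ} (hβ : 0 < β) (y : ℝ → ℝ) {r : ℝ} (hr : 0 < r) :
    (FF β y (β * r^2))^2 * omegaB (2*β) r
      = (exp (β * r^2) * y (β * r^2) ^ 2) * (r^3 / (1 + r^2)^2) / (8 * β^2) := by
  unfold FF omegaB Ufun
  have e : β * r^2 + β = β * (1 + r^2) := by ring
  have e2 : -(2 * β) * r^2 / 2 = -(β * r^2) := by ring
  rw [e, e2, exp_neg]
  have := (exp_pos (β * r^2)).ne'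
  have hp : 1 + r^2 ≠ 0 := by positivity
  field_simp

lemma phi_int {β D : ℝ} (hβ : 0 < β) {y : ℝ → ℝ} (hc : ContinuousOn y (Ioi 0)) (hD : 0 ≤ D)
    (h : ∀ z, 0 < z → exp z * y z ^ 2 ≤ D * exp (-(1/2) * z)) :
    IntegrableOn (fun r => (FF β y (β * r^2))^2 * omegaB (2*β) r) (Ioi 0) := by
  have hg : IntegrableOn (fun r : ℝ => D / (8 * β^2) * exp (-(β/2) * r^2)) (Ioi 0) :=
    ((integrable_exp_neg_mul_sq (by positivity : 0 < β/2)).const_mul _).integrableOn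
  have hmaps : MapsTo (fun r : ℝ => β * r^2) (Ioi 0) (Ioi 0) := fun r hr => by
    have : 0 < r := hr
    exact mem_Ioi.2 (by positivity)
  have hc2 : ContinuousOn (fun r : ℝ => y (β * r^2)) (Ioi 0) :=
    hc.comp (by fun_prop) hmaps
  have hcont : ContinuousOn (fun r : ℝ => (exp (β * r^2) * y (β * r^2) ^ 2) * (r^3 / (1 + r^2)^2) / (8 * β^2)) (Ioi 0) := by
    have h3 : ContinuousOn (fun r : ℝ => r^3 / (1 + r^2)^2) (Ioi 0) :=
      ContinuousOn.div (by fun_prop) (by fun_prop) (fun x _ => by positivity)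
    have h4 : ContinuousOn (fun r : ℝ => exp (β * r^2)) (Ioi 0) := by fun_prop
    exact ((h4.mul (hc2.pow 2)).mul h3).div_const _
  have hI : IntegrableOn (fun r : ℝ => (exp (β * r^2) * y (β * r^2) ^ 2) * (r^3 / (1 + r^2)^2) / (8 * β^2)) (Ioi 0) := by
    refine Integrable.mono' hg (hcont.aestronglyMeasurable measurableSet_Ioi) ?_
    refine (ae_restrict_iff' measurableSet_Ioi).2 (Eventually.of_forall fun r hr => ?_)
    have hr' : 0 < r := hr
    rw [Real.norm_of_nonneg (by positivity)]
    have b1 := h (β * r^2) (by positivity)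
    have b2 : r^3 / (1 + r^2)^2 ≤ 1 := by
      rw [div_le_one (by positivity)]
      nlinarith [sq_nonneg (r^2 - r), sq_nonneg r, pow_pos hr' 3, pow_pos hr' 4]
    calc _ ≤ (D * exp (-(1/2) * (β * r^2))) * 1 / (8 * β^2) := by gcongr
      _ = _ := by
        rw [show -(1/2) * (β * r^2) = -(β/2) * r^2 by ring]; ring
  exact hI.congr_fun (fun r hr => (phi_weight hβ y hr).symm) measurableSet_Ioi

theorem statement_core (n : ℕ) :
    ∃ C : ℝ, 0 < C ∧ ∃ bstar : ℝ, bstar ∈ Set.Ioo (0:ℝ) 1 ∧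
      ∀ b : ℝ, 0 < b → b ≤ bstar →
        ∃ αbar : ℝ, |αbar| ≤ C / (Real.log b) ^ 2 ∧
          ∃ φ : ℝ → ℝ,
            ContDiffOn ℝ (⊤ : ℕ∞) φ (Set.Ioi 0) ∧
            (∃ r ∈ Set.Ioi (0:ℝ), φ r ≠ 0) ∧
            MeasureTheory.IntegrableOn (fun r => (φ r) ^ 2 * omegaB b r) (Set.Ioi 0) ∧
            ∀ r ∈ Set.Ioi (0:ℝ),
              A0 φ r - b * r * deriv φ r
                = 2 * b * (1 - (n : ℝ) + 1 / Real.log b + αbar) * φ r := by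
  obtain ⟨C, L0, R0, hC, hL0, hR0, H⟩ := main_exists n
  refine ⟨C + 1, by positivity, exp (-L0), ⟨exp_pos _, ?_⟩, ?_⟩
  · rw [Real.exp_lt_one_iff]; linarith
  intro b hb hbs
  obtain ⟨β, rfl⟩ : ∃ β, b = 2 * β := ⟨b/2, by ring⟩
  have hβ : 0 < β := by linarith
  have hlog : L0 ≤ -Real.log (2 * β) := by
    have := Real.log_le_log hb hbs
    rw [Real.log_exp] at this
    linarith
  have hLL : -Real.log β = Real.log 2 + -Real.log (2 * β) := by
    rw [Real.log_mul (by norm_num) hβ.ne']; ring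
  have h2' : 0 < Real.log 2 := Real.log_pos (by norm_num)
  obtain ⟨δ, hδ, W, y, hW, hy, hy0, Y, hY0, hY⟩ := H β hβ (by linarith)
  refine ⟨-δ - 1 / Real.log (2 * β), ?_, fun r => FF β y (β * r^2), ?_, ?_, ?_, ?_⟩
  · have := alpha_bound hC (hL0.trans hlog) hLL hδ
    simpa only [neg_neg] using this
  · exact phi_contDiff hβ (contDiffOn_infty.2 fun k => (smooth_sys hβ hW hy k).2)
  · have hev : ∀ᶠ z in 𝓝[>] (0:ℝ), y z ≠ 0 := hy0.eventually_ne one_ne_zero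
    obtain ⟨z, hz1, hz⟩ := (hev.and self_mem_nhdsWithin).exists
    have hz' : 0 < z := hz
    refine ⟨Real.sqrt (z / β), mem_Ioi.2 (Real.sqrt_pos.2 (by positivity)), ?_⟩
    have e : β * Real.sqrt (z / β) ^ 2 = z := by
      rw [Real.sq_sqrt (by positivity)]; field_simp
    show FF β y (β * Real.sqrt (z / β) ^ 2) ≠ 0
    rw [e]
    unfold FF
    exact mul_ne_zero (by positivity) hz1
  · obtain ⟨D, hD, hDb⟩ := y_sq_bdd hR0 (fun z hz => (hy z hz).continuousAt) hy0 hY0 hY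
    exact phi_int hβ (fun z hz => (hy z hz).continuousAt.continuousWithinAt) hD hDb
  · intro r hr
    rw [ode_phi hβ hW hy hr]
    ring

end Final

theorem statement0 (n : ℕ) :
    ∃ C : ℝ, 0 < C ∧ ∃ bstar : ℝ, bstar ∈ Set.Ioo (0:ℝ) 1 ∧
      ∀ b : ℝ, 0 < b → b ≤ bstar →
        ∃ αbar : ℝ, |αbar| ≤ C / (Real.log b) ^ 2 ∧
          ∃ φ : ℝ → ℝ,
            ContDiffOn ℝ (⊤ : ℕ∞) φ (Set.Ioi 0) ∧
            (∃ r ∈ Set.Ioi (0:ℝ), φ r ≠ 0) ∧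
            MeasureTheory.IntegrableOn (fun r => (φ r) ^ 2 * omegaB b r) (Set.Ioi 0) ∧
            ∀ r ∈ Set.Ioi (0:ℝ),
              A0 φ r - b * r * deriv φ r
                = 2 * b * (1 - (n : ℝ) + 1 / Real.log b + αbar) * φ r := by
  exact statement_core n
end

section
/- The functions ψ₀(r) = r²/(1+r²)² and ψ̃₀(r) = (r⁴ + 4 r² ln r − 1)/(1+r²)² satisfy 𝒜₀ ψ₀ = 0 and 𝒜₀ ψ̃₀ = 0 at every r > 0, where 𝒜₀ f = f'' − f'/r + Q f'/r + Q' f/r with Q(r) = 4r²/(1+r²). -/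
open Real

/-- `ψ₀(r) = r²/(1+r²)²`. -/
noncomputable def psi0 (r : ℝ) : ℝ := r ^ 2 / (1 + r ^ 2) ^ 2

/-- `ψ̃₀(r) = (r⁴ + 4r² ln r − 1)/(1+r²)²`. -/
noncomputable def psit0 (r : ℝ) : ℝ := (r ^ 4 + 4 * r ^ 2 * Real.log r - 1) / (1 + r ^ 2) ^ 2

lemma aux_Q (r : ℝ) : deriv Qfun r = 8 * r / (1 + r ^ 2) ^ 2 := by
  have hp : (1 + r ^ 2 : ℝ) ≠ 0 := by positivity
  have h := (((hasDerivAt_id r).pow 2).const_mul 4).div (((hasDerivAt_id r).pow 2).const_add 1) hp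
  have h2 : HasDerivAt Qfun (8 * r / (1 + r ^ 2) ^ 2) r := by
    refine h.congr_deriv ?_
    simp
    field_simp
    ring
  exact h2.deriv

lemma aux_div (N : ℝ → ℝ) (n : ℕ) (N' r : ℝ) (h : HasDerivAt N N' r) :
    HasDerivAt (fun x => N x / (1 + x ^ 2) ^ (n + 1))
      ((N' * (1 + r ^ 2) - 2 * (n + 1) * r * N r) / (1 + r ^ 2) ^ (n + 2)) r := by
  have hp : (1 + r ^ 2 : ℝ) ≠ 0 := by positivity
  have h1 : HasDerivAt (fun x : ℝ => 1 + x ^ 2) (2 * r) r := by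
    simpa using ((hasDerivAt_id r).pow 2).const_add 1
  refine (h.div (h1.pow (n + 1)) (pow_ne_zero _ hp)).congr_deriv ?_
  simp
  field_simp
  ring

lemma aux_pow (n : ℕ) (c r : ℝ) : HasDerivAt (fun x : ℝ => c * x ^ n) (c * (n * r ^ (n - 1))) r :=
  (hasDerivAt_pow n r).const_mul c

lemma aux_powlog (n : ℕ) (c r : ℝ) (hr : 0 < r) :
    HasDerivAt (fun x : ℝ => c * x ^ n * Real.log x)
      (c * (n * r ^ (n - 1)) * Real.log r + c * r ^ n * r⁻¹) r :=
  (aux_pow n c r).mul (Real.hasDerivAt_log hr.ne')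

lemma aux_A0 (f g : ℝ → ℝ) (g' r : ℝ) (hr : 0 < r) (hf : ∀ x, 0 < x → HasDerivAt f (g x) x)
    (hg : HasDerivAt g g' r) :
    A0 f r = g' - g r / r + 4 * r ^ 2 / (1 + r ^ 2) * g r / r
      + 8 * r / (1 + r ^ 2) ^ 2 * f r / r := by
  have he : deriv f =ᶠ[nhds r] g := by
    filter_upwards [lt_mem_nhds hr] with x hx using (hf x hx).deriv
  rw [A0, he.deriv_eq, hg.deriv, (hf r hr).deriv, aux_Q, Qfun]

theorem statement7 :
    ∀ r : ℝ, 0 < r → A0 psi0 r = 0 ∧ A0 psit0 r = 0 := by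
  intro r hr
  have hp : (1 + r ^ 2 : ℝ) ≠ 0 := by positivity
  constructor
  · have hf : ∀ x : ℝ, 0 < x →
        HasDerivAt psi0 ((2 * x ^ 1 - 2 * x ^ 3) / (1 + x ^ 2) ^ (2 + 1)) x := by
      intro x hx
      refine (aux_div (fun x => x ^ 2) 1 _ x (hasDerivAt_pow 2 x)).congr_deriv ?_
      norm_num
      ring
    have hg := aux_div _ 2 _ r ((aux_pow 1 2 r).sub (aux_pow 3 2 r))
    rw [aux_A0 psi0 _ _ r hr hf hg, psi0]
    norm_num
    field_simp
    ring
  · have hf : ∀ x : ℝ, 0 < x →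
        HasDerivAt psit0 ((8 * x ^ 3 + 8 * x ^ 1 + 8 * x ^ 1 * Real.log x
          - 8 * x ^ 3 * Real.log x) / (1 + x ^ 2) ^ (2 + 1)) x := by
      intro x hx
      refine (aux_div (fun x => x ^ 4 + 4 * x ^ 2 * Real.log x - 1) 1 _ x
        (((hasDerivAt_pow 4 x).add (aux_powlog 2 4 x hx)).sub_const 1)).congr_deriv ?_
      norm_num
      field_simp
      ring
    have hg := aux_div _ 2 _ r ((((aux_pow 3 8 r).add (aux_pow 1 8 r)).add
      (aux_powlog 1 8 r hr)).sub (aux_powlog 3 8 r hr))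
    rw [aux_A0 psit0 _ _ r hr hf hg, psit0]
    norm_num
    field_simp
    ring
end
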